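/- arXiv:2211.09482 — 3 statements merged into one kernel-verified Lean document; each statement's English description precedes it below -/
import Mathlib

section
/- Let X be a d-dimensional simplicial complex, G an abelian group and 0 < η < 1. For any f ∈ C^k(X;G) with 0 ≤ k ≤ d, if ‖f‖ ≤ η^{2^{k+1}−1} then ‖S_{−1}‖ = 1 (equivalently, the empty face belongs to S_{−1}). -/
/- Common framework: weighted simplicial complexes, links, localizations,
   local spectral expansion, cochains, coboundaries, minimality, etc. -/

open Finset

open scoped Classical

namespace HDX

variable {V : Type*} [Fintype V] [DecidableEq V]

/-- The faces of cardinality `m` of a family of finite sets.  (A `k`-dimensional face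
has cardinality `k+1`; the `(-1)`-face is the empty set, of cardinality `0`.) -/
def facesCard (Y : Finset (Finset V)) (m : ℕ) : Finset (Finset V) :=
  Y.filter fun s => s.card = m

/-- A simplicial complex: a downwards-closed family of finite sets. -/
def IsComplex (Y : Finset (Finset V)) : Prop :=
  ∀ σ ∈ Y, ∀ τ ⊆ σ, τ ∈ Y

/-- A (pure) `d`-dimensional complex: nonempty, all faces have at most `d+1` vertices, and
every face is contained in a face with exactly `d+1` vertices (a top face). -/
def IsPureDim (Y : Finset (Finset V)) (d : ℕ) : Prop :=
  Y.Nonempty ∧ (∀ σ ∈ Y, σ.card ≤ d + 1) ∧ ∀ σ ∈ Y, ∃ τ ∈ Y, σ ⊆ τ ∧ τ.card = d + 1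

/-- The weight `‖A‖` of a family `A` of faces of cardinality `m`, in a complex whose top
faces have cardinality `t`: pick a top face uniformly at random, then a uniformly random
subset of cardinality `m` of it, and take the probability that it lies in `A`. -/
noncomputable def wt (Y : Finset (Finset V)) (t m : ℕ) (A : Finset (Finset V)) : ℝ :=
  (∑ σ ∈ facesCard Y t, (((σ.powersetCard m).filter (· ∈ A)).card : ℝ)) /
    (((facesCard Y t).card : ℝ) * (t.choose m : ℝ))

/-- The mutual weight `‖(A,B)‖` of `A` (faces of cardinality `m`) and `B` (faces of
cardinality `l`, `l ≤ m`): the probability that a random `m`-subset of a random top face is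
in `A` and a further uniformly random `l`-subset of it is in `B`. -/
noncomputable def mwt (Y : Finset (Finset V)) (t m l : ℕ) (A B : Finset (Finset V)) : ℝ :=
  (∑ σ ∈ facesCard Y t, ∑ τ ∈ (σ.powersetCard m).filter (· ∈ A),
      (((τ.powersetCard l).filter (· ∈ B)).card : ℝ)) /
    (((facesCard Y t).card : ℝ) * (t.choose m : ℝ) * (m.choose l : ℝ))

/-- Localization of a family `A` to (the link of) a face `σ`:
`A_σ = {τ \ σ | σ ⊆ τ ∈ A}`. -/
def localize (A : Finset (Finset V)) (σ : Finset V) : Finset (Finset V) :=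
  (A.filter fun τ => σ ⊆ τ).image fun τ => τ \ σ

/-- The link `X_σ = {τ \ σ | σ ⊆ τ ∈ X}` of a face `σ`. -/
def link (Y : Finset (Finset V)) (σ : Finset V) : Finset (Finset V) :=
  localize Y σ

/-- `locWt Y t A m σ` is the weight `‖A_σ‖` of the localization to the link of `σ` of the
family `A` of faces of cardinality `m`, where `Y` has top faces of cardinality `t`. -/
noncomputable def locWt (Y : Finset (Finset V)) (t : ℕ) (A : Finset (Finset V)) (m : ℕ)
    (σ : Finset V) : ℝ :=
  wt (link Y σ) (t - σ.card) (m - σ.card) (localize A σ)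

/-- `w` is (the weight function of) a weighted graph which is a `λ`-spectral expander:
for every function orthogonal to the constants (in the weighted inner product) the Rayleigh
quotient of the normalized adjacency operator is at most `λ` in absolute value. -/
def IsSpectralExpanderW (w : V → V → ℝ) (lam : ℝ) : Prop :=
  ∀ f : V → ℝ, (∑ u, (∑ v, w u v) * f u) = 0 →
    |∑ u, ∑ v, w u v * f u * f v| ≤ lam * ∑ u, (∑ v, w u v) * f u ^ 2

/-- The weight of the edge `{u,v}` in the underlying weighted graph of a complex with top
faces of cardinality `t`. -/
noncomputable def edgeWt (Y : Finset (Finset V)) (t : ℕ) (u v : V) : ℝ :=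
  if u ≠ v then wt Y t 2 {({u, v} : Finset V)} else 0

/-- `λ`-local spectral expander: the underlying weighted graph of the link of every face of
dimension at most `d-2` (including the empty face) is a `λ`-spectral expander. -/
def IsLocalSpectralExpander (Y : Finset (Finset V)) (d : ℕ) (lam : ℝ) : Prop :=
  ∀ σ ∈ Y, σ.card + 2 ≤ d + 1 →
    IsSpectralExpanderW (edgeWt (link Y σ) (d + 1 - σ.card)) lam

/-- `q`-bounded degree: every vertex is contained in at most `q` top faces. -/
def IsBoundedDegree (Y : Finset (Finset V)) (d q : ℕ) : Prop :=
  ∀ v : V, ((facesCard Y (d + 1)).filter fun σ => v ∈ σ).card ≤ q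

/-- The skeleton consisting of the faces with at most `m` vertices
(i.e. of dimension at most `m - 1`). -/
def skeleton (Y : Finset (Finset V)) (m : ℕ) : Finset (Finset V) :=
  Y.filter fun σ => σ.card ≤ m

/-- `δ₁(A)`: the faces of cardinality `m+1` that contain exactly one member of `A`
(a family of faces of cardinality `m`). -/
def delta1 (Y : Finset (Finset V)) (m : ℕ) (A : Finset (Finset V)) : Finset (Finset V) :=
  (facesCard Y (m + 1)).filter fun τ => ((τ.powersetCard m).filter (· ∈ A)).card = 1

/-- For `A ⊆ X(k)`, the set `S_{k-1}` of `(k-1)`-faces `σ` with `‖A_σ‖ ≤ η`. -/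
noncomputable def nonlocalS (Y : Finset (Finset V)) (t k : ℕ) (A : Finset (Finset V))
    (η : ℝ) : Finset (Finset V) :=
  (facesCard Y k).filter fun σ => locWt Y t A (k + 1) σ ≤ η

/-- `A ⊆ X(k)` is `(η,ε)`-non-local if `‖(A, S_{k-1})‖ ≥ (1-ε)‖A‖`. -/
def IsNonlocal (Y : Finset (Finset V)) (t k : ℕ) (A : Finset (Finset V)) (η ε : ℝ) : Prop :=
  mwt Y t (k + 1) k A (nonlocalS Y t k A η) ≥ (1 - ε) * wt Y t (k + 1) A

/-- For `A ⊆ X(k)`, the set `S_{k-2}` of `(k-2)`-faces `σ` with `‖A_σ‖ ≤ η`. -/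
noncomputable def weakS (Y : Finset (Finset V)) (t k : ℕ) (A : Finset (Finset V))
    (η : ℝ) : Finset (Finset V) :=
  (facesCard Y (k - 1)).filter fun σ => locWt Y t A (k + 1) σ ≤ η

/-- `A ⊆ X(k)` is `(η,ε,α)`-weakly-non-local if `‖S_{k-2}‖ ≥ 1 - ε‖A‖` and `‖A_τ‖ ≤ 1-α`
for every `(k-1)`-face `τ`. -/
def IsWeaklyNonlocal (Y : Finset (Finset V)) (t k : ℕ) (A : Finset (Finset V))
    (η ε α : ℝ) : Prop :=
  wt Y t (k - 1) (weakS Y t k A η) ≥ 1 - ε * wt Y t (k + 1) A ∧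
    ∀ τ ∈ facesCard Y k, locWt Y t A (k + 1) τ ≤ 1 - α

section Abelian

variable {G : Type*} [AddCommGroup G]

/-- An ordered face of the complex: an injective tuple whose image is a face. -/
def IsFaceTup (Y : Finset (Finset V)) {m : ℕ} (tup : Fin m → V) : Prop :=
  Function.Injective tup ∧ Finset.image tup Finset.univ ∈ Y

/-- A cochain over an abelian group `G` on the faces with `m` vertices (i.e. an
`(m-1)`-dimensional cochain): an antisymmetric `G`-valued function on ordered faces,
vanishing on tuples which are not ordered faces. -/
def IsCochain (Y : Finset (Finset V)) {m : ℕ} (f : (Fin m → V) → G) : Prop :=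
  (∀ (tup : Fin m → V) (π : Equiv.Perm (Fin m)),
      f (tup ∘ π) = ((Equiv.Perm.sign π : ℤˣ) : ℤ) • f tup) ∧
    ∀ tup : Fin m → V, ¬IsFaceTup Y tup → f tup = 0

/-- The coboundary operator `δ(f)(v_0,…,v_m) = ∑ i, (-1)^i f(v_0,…,v_{i-1},v_{i+1},…,v_m)`. -/
def cob {m : ℕ} (f : (Fin m → V) → G) : (Fin (m + 1) → V) → G := fun tup =>
  ∑ i : Fin (m + 1), ((-1 : ℤ) ^ (i : ℕ)) • f (tup ∘ i.succAbove)

/-- The support of `f`: the faces (with `m` vertices) on which `f` does not vanish. -/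
noncomputable def suppC (Y : Finset (Finset V)) {m : ℕ} (f : (Fin m → V) → G) :
    Finset (Finset V) :=
  (facesCard Y m).filter fun σ =>
    ∃ tup : Fin m → V, Finset.image tup Finset.univ = σ ∧ f tup ≠ 0

/-- The norm `‖f‖` of a cochain: the weight of its support. -/
noncomputable def normC (Y : Finset (Finset V)) (t : ℕ) {m : ℕ} (f : (Fin m → V) → G) : ℝ :=
  wt Y t m (suppC Y f)

/-- A cocycle: a cochain whose coboundary vanishes on all (ordered) faces. -/
def IsCocycle (Y : Finset (Finset V)) {m : ℕ} (f : (Fin m → V) → G) : Prop :=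
  IsCochain Y f ∧ ∀ tup : Fin (m + 1) → V, IsFaceTup Y tup → cob f tup = 0

/-- A coboundary: a function agreeing on all ordered faces with the coboundary of a cochain
of one dimension below. -/
def IsCoboundaryFn (Y : Finset (Finset V)) {m : ℕ} (f : (Fin (m + 1) → V) → G) : Prop :=
  ∃ g : (Fin m → V) → G, IsCochain Y g ∧
    ∀ tup : Fin (m + 1) → V, IsFaceTup Y tup → f tup = cob g tup

/-- The distance of `f` from the coboundaries. -/
noncomputable def distB (Y : Finset (Finset V)) (t : ℕ) {m : ℕ}
    (f : (Fin (m + 1) → V) → G) : ℝ :=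
  sInf {r : ℝ | ∃ g : (Fin m → V) → G, IsCochain Y g ∧
    r = normC Y t fun tup => f tup - cob g tup}

/-- The distance of `f` from the cocycles. -/
noncomputable def distZ (Y : Finset (Finset V)) (t : ℕ) {m : ℕ}
    (f : (Fin m → V) → G) : ℝ :=
  sInf {r : ℝ | ∃ g : (Fin m → V) → G, IsCocycle Y g ∧
    r = normC Y t fun tup => f tup - g tup}

/-- A minimal cochain: its weight cannot be decreased by adding a coboundary. -/
def IsMinimal (Y : Finset (Finset V)) (t : ℕ) {m : ℕ} (f : (Fin (m + 1) → V) → G) : Prop :=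
  ∀ g : (Fin m → V) → G, IsCochain Y g →
    normC Y t f ≤ normC Y t fun tup => f tup - cob g tup

/-- The localization `f_v` of a cochain to the link of a vertex `v`: `f_v(τ) = f(vτ)`. -/
def localizeC {m : ℕ} (f : (Fin (m + 1) → V) → G) (v : V) : (Fin m → V) → G :=
  fun tup => f (Fin.cons v tup)

/-- A locally minimal cochain: all its localizations to links of vertices are minimal. -/
def IsLocallyMinimal (Y : Finset (Finset V)) (t : ℕ) {m : ℕ}
    (f : (Fin (m + 2) → V) → G) : Prop :=
  ∀ v : V, ({v} : Finset V) ∈ Y → IsMinimal (link Y {v}) (t - 1) (localizeC f v)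

/-- A `β`-coboundary expander over `G` (for a complex with top faces of cardinality `t`):
for every dimension below the dimension of the complex, every cochain which is not a
coboundary satisfies `‖δ(f)‖ ≥ β · dist(f, B)`. -/
def IsCoboundaryExpander (Y : Finset (Finset V)) (t : ℕ) (G : Type*) [AddCommGroup G]
    (β : ℝ) : Prop :=
  ∀ m : ℕ, m + 2 ≤ t → ∀ f : (Fin (m + 1) → V) → G, IsCochain Y f → ¬IsCoboundaryFn Y f →
    normC Y t (cob f) ≥ β * distB Y t f

/-- The links (of all nonempty faces) of `Y` are `β`-coboundary expanders over `G`. -/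
def HasCobExpandingLinks (Y : Finset (Finset V)) (d : ℕ) (G : Type*) [AddCommGroup G]
    (β : ℝ) : Prop :=
  ∀ σ ∈ Y, σ.Nonempty → IsCoboundaryExpander (link Y σ) (d + 1 - σ.card) G β

/-- For a family `A` of faces with `c` vertices (i.e. `A ⊆ X(k)` with `c = k+1`),
`Sbar Y t c A η r` is the set `S̄_{k-1-r}` of "fat" faces of cardinality `c-1-r`:
`S̄_{k-1} = {σ ∈ X(k-1) : ‖A_σ‖ > η}` and, going down,
`S̄_i = {σ ∈ X(i) : ‖(S̄_{i+1})_σ‖ > η^{2^{k-i-1}}}`. -/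
noncomputable def Sbar (Y : Finset (Finset V)) (t c : ℕ) (A : Finset (Finset V)) (η : ℝ) :
    ℕ → Finset (Finset V)
  | 0 => (facesCard Y (c - 1)).filter fun σ => η < locWt Y t A c σ
  | r + 1 =>
      (facesCard Y (c - 1 - (r + 1))).filter fun σ =>
        η ^ 2 ^ (r + 1) < locWt Y t (Sbar Y t c A η r) (c - 1 - r) σ

/-- `Υ`: the set of `(k+1)`-faces (cardinality `c+1`, where `c = k+1`) containing two
`i`-faces `σ, σ' ∈ S̄_i` (for some `i ≥ 0`) with `σ ∪ σ' ∈ X(i+1)` and `σ ∩ σ' ∈ S_{i-1}`. -/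
noncomputable def Upsilon (Y : Finset (Finset V)) (t c : ℕ) (A : Finset (Finset V))
    (η : ℝ) : Finset (Finset V) :=
  (facesCard Y (c + 1)).filter fun τ => ∃ r : ℕ, r + 2 ≤ c ∧
    ∃ σ ∈ Sbar Y t c A η r, ∃ σ' ∈ Sbar Y t c A η r, σ ⊆ τ ∧ σ' ⊆ τ ∧
      σ ∪ σ' ∈ facesCard Y (c - r) ∧
      σ ∩ σ' ∈ facesCard Y (c - 2 - r) \ Sbar Y t c A η (r + 1)

/-- `f↓σ` (for `σ` of cardinality `c-1-r`, i.e. an `(k-r)`-dimensional... face): the members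
`τ` of `A` admitting a chain of containments `τ ⊃ τ_{k-1} ⊃ ⋯ ⊃ τ_{i+1} ⊃ σ` with each
`τ_j ∈ S̄_j`. -/
noncomputable def fdown (Y : Finset (Finset V)) (t c : ℕ) (A : Finset (Finset V)) (η : ℝ) :
    ℕ → Finset V → Finset (Finset V)
  | 0, σ => A.filter fun τ => σ ⊆ τ
  | r + 1, σ =>
      A.filter fun τ => ∃ τ' ∈ Sbar Y t c A η r, σ ⊆ τ' ∧ τ' ≠ σ ∧ τ ∈ fdown Y t c A η r τ'

end Abelian

section NonAbelian

variable {G : Type*} [Group G]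

/-- A 0-cochain over a (possibly non-abelian) group: vanishes on non-vertices. -/
def IsC0 (Y : Finset (Finset V)) (f : V → G) : Prop :=
  ∀ v : V, ({v} : Finset V) ∉ Y → f v = 1

/-- A 1-cochain over a (possibly non-abelian) group: antisymmetric, supported on edges. -/
def IsC1 (Y : Finset (Finset V)) (g : V → V → G) : Prop :=
  (∀ u v : V, g v u = (g u v)⁻¹) ∧
    ∀ u v : V, ({u, v} : Finset V) ∉ Y ∨ u = v → g u v = 1

/-- A 2-cochain over a (possibly non-abelian) group: antisymmetric, supported on triangles. -/
def IsC2 (Y : Finset (Finset V)) (f : V → V → V → G) : Prop :=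
  (∀ u v w : V, f u v w = f v w u) ∧ (∀ u v w : V, f v u w = (f u v w)⁻¹) ∧
    ∀ u v w : V, ({u, v, w} : Finset V) ∉ Y ∨ u = v ∨ u = w ∨ v = w → f u v w = 1

/-- The coboundary of a 0-cochain: `δ(f)(u,v) = f(u)·f(v)⁻¹`. -/
def d0 (f : V → G) : V → V → G := fun u v => f u * (f v)⁻¹

/-- The coboundary of a 1-cochain: `δ(g)(u,v,w) = g(u,v)·g(v,w)·g(w,u)`. -/
def d1 (g : V → V → G) : V → V → V → G := fun u v w => g u v * g v w * g w u

/-- The support (a set of vertices, as singleton faces) of a `G`-valued function. -/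
noncomputable def supp0 (Y : Finset (Finset V)) (f : V → G) : Finset (Finset V) :=
  (facesCard Y 1).filter fun s => ∃ v : V, ({v} : Finset V) = s ∧ f v ≠ 1

/-- The support (a set of edges) of a `G`-valued function on ordered edges. -/
noncomputable def supp1 (Y : Finset (Finset V)) (g : V → V → G) : Finset (Finset V) :=
  (facesCard Y 2).filter fun e => ∃ u v : V, ({u, v} : Finset V) = e ∧ u ≠ v ∧ g u v ≠ 1

/-- The support (a set of triangles) of a `G`-valued function on ordered triangles. -/
noncomputable def supp2 (Y : Finset (Finset V)) (f : V → V → V → G) : Finset (Finset V) :=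
  (facesCard Y 3).filter fun s =>
    ∃ u v w : V, ({u, v, w} : Finset V) = s ∧ u ≠ v ∧ u ≠ w ∧ v ≠ w ∧ f u v w ≠ 1

/-- The action of 0-cochains on 1-cochains: `h.g(u,v) = h(u)·g(u,v)·h(v)⁻¹`. -/
def act (h : V → G) (g : V → V → G) : V → V → G := fun u v => h u * g u v * (h v)⁻¹

/-- The norm of a 1-cochain: the weight of its support. -/
noncomputable def norm1 (Y : Finset (Finset V)) (t : ℕ) (g : V → V → G) : ℝ :=
  wt Y t 2 (supp1 Y g)

/-- The norm of a 2-cochain: the weight of its support. -/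
noncomputable def norm2 (Y : Finset (Finset V)) (t : ℕ) (f : V → V → V → G) : ℝ :=
  wt Y t 3 (supp2 Y f)

/-- The distance between two 1-cochains: `dist(g,g') = ‖g'g⁻¹‖`. -/
noncomputable def dist1 (Y : Finset (Finset V)) (t : ℕ) (g g' : V → V → G) : ℝ :=
  norm1 Y t fun u v => g' u v * (g u v)⁻¹

/-- A minimal 1-cochain: its weight cannot be decreased by acting with a 0-cochain. -/
def Minimal1 (Y : Finset (Finset V)) (t : ℕ) (g : V → V → G) : Prop :=
  ∀ h : V → G, IsC0 Y h → norm1 Y t g ≤ norm1 Y t (act h g)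

/-- The localization `f_v` of a 2-cochain to the link of `v`: `f_v(u,w) = f(v,u,w)`. -/
def locC1 (f : V → V → V → G) (v : V) : V → V → G := fun u w => f v u w

/-- A locally minimal 2-cochain: all its localizations to links of vertices are minimal. -/
def LocallyMinimal2 (Y : Finset (Finset V)) (t : ℕ) (f : V → V → V → G) : Prop :=
  ∀ v : V, ({v} : Finset V) ∈ Y → Minimal1 (link Y {v}) (t - 1) (locC1 f v)

/-- A 1-coboundary: `g = δ(h)` on the edges, for some 0-cochain `h`. -/
def IsCoboundary1 (Y : Finset (Finset V)) (g : V → V → G) : Prop :=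
  ∃ h : V → G, IsC0 Y h ∧
    ∀ u v : V, ({u, v} : Finset V) ∈ Y → u ≠ v → g u v = h u * (h v)⁻¹

/-- A 1-cocycle: a 1-cochain whose coboundary is trivial on all triangles. -/
def IsCocycle1 (Y : Finset (Finset V)) (g : V → V → G) : Prop :=
  IsC1 Y g ∧ ∀ u v w : V, ({u, v, w} : Finset V) ∈ Y → u ≠ v → u ≠ w → v ≠ w →
    d1 g u v w = 1

/-- A constant 0-cochain (member of `B⁰`). -/
def IsConst0 (Y : Finset (Finset V)) (f : V → G) : Prop :=
  ∃ c : G, ∀ v : V, ({v} : Finset V) ∈ Y → f v = c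

/-- The distance of a 0-cochain from `B⁰` (the constants). -/
noncomputable def distB0 (Y : Finset (Finset V)) (t : ℕ) (f : V → G) : ℝ :=
  sInf {r : ℝ | ∃ c : G, r = wt Y t 1 (supp0 Y fun v => f v * c⁻¹)}

/-- The distance of a 1-cochain from the 1-coboundaries. -/
noncomputable def distB1 (Y : Finset (Finset V)) (t : ℕ) (g : V → V → G) : ℝ :=
  sInf {r : ℝ | ∃ h : V → G, IsC0 Y h ∧ r = dist1 Y t g (act h g)}

/-- The distance of a 1-cochain from the 1-cocycles. -/
noncomputable def distZ1 (Y : Finset (Finset V)) (t : ℕ) (g : V → V → G) : ℝ :=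
  sInf {r : ℝ | ∃ g' : V → V → G, IsCocycle1 Y g' ∧ r = dist1 Y t g g'}

/-- A `β`-coboundary expander over a (possibly non-abelian) group `G`, for a complex with top
faces of cardinality `t`: in every dimension (0 and 1) below the dimension of the complex,
every cochain which is not a coboundary satisfies `‖δ(f)‖ ≥ β·dist(f,B)`. -/
def CobExpanderNA (Y : Finset (Finset V)) (t : ℕ) (G : Type*) [Group G] (β : ℝ) : Prop :=
  (2 ≤ t → ∀ f : V → G, IsC0 Y f → ¬IsConst0 Y f →
      norm1 Y t (d0 f) ≥ β * distB0 Y t f) ∧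
    (3 ≤ t → ∀ g : V → V → G, IsC1 Y g → ¬IsCoboundary1 Y g →
      norm2 Y t (d1 g) ≥ β * distB1 Y t g)

/-- The links (of all nonempty faces) of `Y` are `β`-coboundary expanders over `G`. -/
def HasCobExpandingLinksNA (Y : Finset (Finset V)) (d : ℕ) (G : Type*) [Group G]
    (β : ℝ) : Prop :=
  ∀ σ ∈ Y, σ.Nonempty → CobExpanderNA (link Y σ) (d + 1 - σ.card) G β

end NonAbelian

end HDX

section Helpers

variable {V : Type*} [Fintype V] [DecidableEq V]

theorem HDX.locWt_eq (X : Finset (Finset V)) (t m : ℕ) (A : Finset (Finset V)) (σ : Finset V)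
    (hσ : σ.card = m) (hmt : m + 1 ≤ t) :
    HDX.locWt X t A (m + 1) σ =
      (∑ T ∈ (HDX.facesCard X t).filter (fun T => σ ⊆ T),
        ((((T.powersetCard (m + 1)).filter (· ∈ A)).filter (fun τ => σ ⊆ τ)).card : ℝ)) /
      ((((HDX.facesCard X t).filter (fun T => σ ⊆ T)).card : ℝ) * ((t - m : ℕ) : ℝ)) := by
  have hinj : Set.InjOn (fun T : Finset V => T \ σ)
      ((HDX.facesCard X t).filter (fun T => σ ⊆ T) : Finset (Finset V)) := by
    intro a ha b hb hab
    simp only [Finset.coe_filter, Set.mem_ofPred_eq] at ha hb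
    have hab' : a \ σ = b \ σ := hab
    rw [← Finset.sdiff_union_of_subset ha.2, ← Finset.sdiff_union_of_subset hb.2, hab']
  have htop : HDX.facesCard (HDX.link X σ) (t - m) =
      ((HDX.facesCard X t).filter (fun T => σ ⊆ T)).image (fun T => T \ σ) := by
    ext s
    simp only [HDX.facesCard, HDX.link, HDX.localize, Finset.mem_filter, Finset.mem_image]
    constructor
    · rintro ⟨⟨T, ⟨hT, hs⟩, rfl⟩, hc⟩
      refine ⟨T, ⟨⟨hT, ?_⟩, hs⟩, rfl⟩
      have h1 := Finset.card_sdiff_add_card_eq_card hs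
      omega
    · rintro ⟨T, ⟨⟨hT, hc⟩, hs⟩, rfl⟩
      refine ⟨⟨T, ⟨hT, hs⟩, rfl⟩, ?_⟩
      have h1 := Finset.card_sdiff_add_card_eq_card hs
      omega
  unfold HDX.locWt HDX.wt
  rw [hσ, htop, Finset.sum_image hinj, Finset.card_image_of_injOn hinj]
  have h1 : m + 1 - m = 1 := by omega
  rw [h1, Nat.choose_one_right]
  congr 1
  apply Finset.sum_congr rfl
  intro T hT
  simp only [Finset.mem_filter] at hT
  norm_cast
  symm
  apply Finset.card_bij (fun τ _ => τ \ σ)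
  · intro τ hτ
    simp only [Finset.mem_filter, Finset.mem_powersetCard, HDX.localize, Finset.mem_image] at hτ ⊢
    obtain ⟨⟨⟨h2, h3⟩, h4⟩, h5⟩ := hτ
    have h6 := Finset.card_sdiff_add_card_eq_card h5
    exact ⟨⟨Finset.sdiff_subset_sdiff h2 (le_refl _), by omega⟩, τ, ⟨h4, h5⟩, rfl⟩
  · intro a ha b hb hab
    simp only [Finset.mem_filter] at ha hb
    rw [← Finset.sdiff_union_of_subset ha.2, ← Finset.sdiff_union_of_subset hb.2, hab]
  · intro s hs
    simp only [Finset.mem_filter, Finset.mem_powersetCard, HDX.localize, Finset.mem_image] at hs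
    obtain ⟨⟨h2, h3⟩, τ, ⟨h4, h5⟩, rfl⟩ := hs
    refine ⟨τ, ?_, rfl⟩
    simp only [Finset.mem_filter, Finset.mem_powersetCard]
    have h6 := Finset.card_sdiff_add_card_eq_card h5
    refine ⟨⟨⟨?_, by omega⟩, h4⟩, h5⟩
    rw [← Finset.sdiff_union_of_subset h5]
    exact Finset.union_subset (h2.trans Finset.sdiff_subset) hT.2

theorem HDX.markov (X : Finset (Finset V)) (t m : ℕ) (A B : Finset (Finset V)) (θ : ℝ)
    (hmt : m + 1 ≤ t) (hB : ∀ σ ∈ B, σ.card = m)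
    (hθ : ∀ σ ∈ B, θ < HDX.locWt X t A (m + 1) σ) :
    θ * HDX.wt X t m B ≤ HDX.wt X t (m + 1) A := by
  have h1 : ∀ σ ∈ B, θ * ((((HDX.facesCard X t).filter (fun T => σ ⊆ T)).card : ℝ) *
      ((t - m : ℕ) : ℝ)) ≤ ∑ T ∈ (HDX.facesCard X t).filter (fun T => σ ⊆ T),
        ((((T.powersetCard (m + 1)).filter (· ∈ A)).filter (fun τ => σ ⊆ τ)).card : ℝ) := by
    intro σ hσ
    have h := hθ σ hσ
    rw [HDX.locWt_eq X t m A σ (hB σ hσ) hmt] at h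
    set b : ℝ := ((((HDX.facesCard X t).filter (fun T => σ ⊆ T)).card : ℝ) *
      ((t - m : ℕ) : ℝ)) with hb
    have hb0 : 0 ≤ b := mul_nonneg (Nat.cast_nonneg _) (Nat.cast_nonneg _)
    rcases hb0.eq_or_lt with h0 | h0
    · rw [← h0, mul_zero]
      exact Finset.sum_nonneg fun _ _ => Nat.cast_nonneg _
    · exact ((lt_div_iff₀ h0).1 h).le
  have h2 := Finset.sum_le_sum h1
  have e1 : ∑ σ ∈ B, (((HDX.facesCard X t).filter (fun T => σ ⊆ T)).card : ℝ) =
      ∑ T ∈ HDX.facesCard X t, (((T.powersetCard m).filter (· ∈ B)).card : ℝ) := by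
    norm_cast
    simp only [Finset.card_filter]
    rw [Finset.sum_comm]
    apply Finset.sum_congr rfl
    intro T _
    rw [← Finset.card_filter, ← Finset.card_filter]
    congr 1
    ext σ
    simp only [Finset.mem_filter, Finset.mem_powersetCard]
    constructor
    · rintro ⟨h, h'⟩
      exact ⟨⟨h', hB σ h⟩, h⟩
    · rintro ⟨⟨h, _⟩, h'⟩
      exact ⟨h', h⟩
  have e2 : ∑ σ ∈ B, ∑ T ∈ (HDX.facesCard X t).filter (fun T => σ ⊆ T),
        ((((T.powersetCard (m + 1)).filter (· ∈ A)).filter (fun τ => σ ⊆ τ)).card : ℝ) ≤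
      ∑ T ∈ HDX.facesCard X t,
        (((T.powersetCard (m + 1)).filter (· ∈ A)).card : ℝ) * ((m + 1 : ℕ) : ℝ) := by
    calc _ ≤ ∑ σ ∈ B, ∑ T ∈ HDX.facesCard X t,
        ((((T.powersetCard (m + 1)).filter (· ∈ A)).filter (fun τ => σ ⊆ τ)).card : ℝ) := by
          apply Finset.sum_le_sum
          intro σ _
          apply Finset.sum_le_sum_of_subset_of_nonneg (Finset.filter_subset _ _)
          exact fun _ _ _ => Nat.cast_nonneg _
      _ = ∑ T ∈ HDX.facesCard X t, ∑ σ ∈ B,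
        ((((T.powersetCard (m + 1)).filter (· ∈ A)).filter (fun τ => σ ⊆ τ)).card : ℝ) :=
          Finset.sum_comm
      _ ≤ _ := by
          apply Finset.sum_le_sum
          intro T _
          norm_cast
          simp only [Finset.card_filter _ (Finset.filter _ _)]
          rw [Finset.sum_comm, ← smul_eq_mul]
          apply Finset.sum_le_card_nsmul
          intro τ hτ
          rw [← Finset.card_filter]
          simp only [Finset.mem_filter, Finset.mem_powersetCard] at hτ
          calc _ ≤ (τ.powersetCard m).card := by
                apply Finset.card_le_card
                intro σ hσ
                simp only [Finset.mem_filter, Finset.mem_powersetCard] at hσ ⊢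
                exact ⟨hσ.2, hB σ hσ.1⟩
            _ = m + 1 := by
                rw [Finset.card_powersetCard, hτ.1.2, Nat.choose_succ_self_right]
  rw [← Finset.mul_sum, ← Finset.sum_mul, e1] at h2
  have h3 := h2.trans e2
  rw [← Finset.sum_mul] at h3
  unfold HDX.wt
  set SB := ∑ T ∈ HDX.facesCard X t, (((T.powersetCard m).filter (· ∈ B)).card : ℝ)
  set SA := ∑ T ∈ HDX.facesCard X t, (((T.powersetCard (m + 1)).filter (· ∈ A)).card : ℝ)
  have hch : ((t.choose (m + 1) : ℕ) : ℝ) * ((m + 1 : ℕ) : ℝ) =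
      ((t.choose m : ℕ) : ℝ) * ((t - m : ℕ) : ℝ) := by
    exact_mod_cast Nat.choose_succ_right_eq t m
  rcases (Nat.zero_le (HDX.facesCard X t).card).eq_or_lt with hN | hN
  · rw [← hN]; simp
  · have hN' : (0 : ℝ) < ((HDX.facesCard X t).card : ℝ) := by exact_mod_cast hN
    have c1 : (0 : ℝ) < (t.choose m : ℕ) := by
      exact_mod_cast Nat.choose_pos (by omega)
    have c2 : (0 : ℝ) < (t.choose (m + 1) : ℕ) := by
      exact_mod_cast Nat.choose_pos hmt
    have c3 : (0 : ℝ) < ((m + 1 : ℕ) : ℝ) := by positivity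
    have c4 : (0 : ℝ) < ((t - m : ℕ) : ℝ) := by
      exact_mod_cast (by omega : 0 < t - m)
    rw [mul_div_assoc', div_le_div_iff₀ (by positivity) (by positivity)]
    refine le_of_mul_le_mul_right ?_ c3
    calc _ = (θ * (SB * ((t - m : ℕ) : ℝ))) *
          (((HDX.facesCard X t).card : ℝ) * (t.choose m : ℕ)) := by
            linear_combination θ * SB * ((HDX.facesCard X t).card : ℝ) * hch
      _ ≤ (SA * ((m + 1 : ℕ) : ℝ)) * (((HDX.facesCard X t).card : ℝ) * (t.choose m : ℕ)) :=
          mul_le_mul_of_nonneg_right h3 (by positivity)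
      _ = _ := by ring

theorem HDX.Sbar_card (X : Finset (Finset V)) (t c : ℕ) (A : Finset (Finset V)) (η : ℝ) (r : ℕ) :
    ∀ σ ∈ HDX.Sbar X t c A η r, σ.card = c - 1 - r := by
  intro σ hσ
  cases r <;> simp only [HDX.Sbar, HDX.facesCard, Finset.mem_filter] at hσ <;> exact hσ.1.2

theorem HDX.Sbar_bound (X : Finset (Finset V)) (t k : ℕ) (A : Finset (Finset V)) (η : ℝ)
    (hη : 0 < η) (hkt : k + 1 ≤ t) (r : ℕ) (hr : r ≤ k) :
    η ^ (2 ^ (r + 1) - 1) * HDX.wt X t (k - r) (HDX.Sbar X t (k + 1) A η r) ≤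
      HDX.wt X t (k + 1) A := by
  induction r with
  | zero =>
    have := HDX.markov X t k A (HDX.Sbar X t (k + 1) A η 0) η hkt
      (by simpa using HDX.Sbar_card X t (k + 1) A η 0)
      (by
        intro σ hσ
        simp only [HDX.Sbar, Finset.mem_filter] at hσ
        exact hσ.2)
    simpa using this
  | succ r ih =>
    have h1 := ih (by omega)
    have h2 := HDX.markov X t (k - (r + 1)) (HDX.Sbar X t (k + 1) A η r)
      (HDX.Sbar X t (k + 1) A η (r + 1)) (η ^ 2 ^ (r + 1)) (by omega)
      (by simpa using HDX.Sbar_card X t (k + 1) A η (r + 1))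
      (by
        intro σ hσ
        rw [HDX.Sbar, Finset.mem_filter] at hσ
        have e : k - (r + 1) + 1 = k + 1 - 1 - r := by omega
        rw [e]
        exact hσ.2)
    have e : k - (r + 1) + 1 = k - r := by omega
    rw [e] at h2
    have e3 : 2 ^ (r + 1 + 1) - 1 = (2 ^ (r + 1) - 1) + 2 ^ (r + 1) := by
      have : 0 < 2 ^ (r + 1) := by positivity
      rw [pow_succ 2 (r + 1)]
      omega
    rw [e3, pow_add η, mul_assoc]
    exact (mul_le_mul_of_nonneg_left h2 (by positivity)).trans h1

theorem HDX.locWt_empty (X : Finset (Finset V)) (t m : ℕ) (A : Finset (Finset V)) :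
    HDX.locWt X t A m ∅ = HDX.wt X t m A := by
  simp [HDX.locWt, HDX.link, HDX.localize]

end Helpers

/-- for any cochain `f ∈ C^k(X;G)` (`0 ≤ k ≤ d`), if
`‖f‖ ≤ η^(2^(k+1) - 1)` then `‖S_{-1}‖ = 1`, i.e. the empty face belongs to `S_{-1}`. -/
theorem stmt7 {V : Type*} [Fintype V] [DecidableEq V] {G : Type*} [AddCommGroup G]
    (X : Finset (Finset V)) (d : ℕ) (hX : HDX.IsComplex X) (hXd : HDX.IsPureDim X d)
    (η : ℝ) (hη0 : 0 < η) (hη1 : η < 1)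
    (k : ℕ) (hk : k ≤ d)
    (f : (Fin (k + 1) → V) → G) (hf : HDX.IsCochain X f)
    (hsmall : HDX.wt X (d + 1) (k + 1) (HDX.suppC X f) ≤ η ^ (2 ^ (k + 1) - 1)) :
    HDX.wt X (d + 1) 0
      (HDX.facesCard X 0 \ HDX.Sbar X (d + 1) (k + 1) (HDX.suppC X f) η k) = 1 := by
  have hkey : ∅ ∉ HDX.Sbar X (d + 1) (k + 1) (HDX.suppC X f) η k := by
    intro hmem
    cases k with
    | zero =>
      simp only [HDX.Sbar, Finset.mem_filter, HDX.locWt_empty] at hmem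
      have := hmem.2
      simp at hsmall this
      linarith
    | succ r =>
      rw [HDX.Sbar, Finset.mem_filter, HDX.locWt_empty] at hmem
      have h1 := HDX.Sbar_bound X (d + 1) (r + 1) (HDX.suppC X f) η hη0 (by omega) r (by omega)
      have e : r + 1 + 1 - 1 - r = r + 1 - r := by omega
      have h2 := hmem.2
      rw [e] at h2
      have e3 : 2 ^ (r + 1 + 1) - 1 = (2 ^ (r + 1) - 1) + 2 ^ (r + 1) := by
        have : 0 < 2 ^ (r + 1) := by positivity
        rw [pow_succ 2 (r + 1)]
        omega
      have h3 := h1.trans hsmall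
      rw [e3, pow_add η] at h3
      have h4 := le_of_mul_le_mul_left h3 (by positivity)
      linarith
  obtain ⟨⟨σ₀, hσ₀⟩, -, htop⟩ := hXd
  have hempty : ∅ ∈ X := hX σ₀ hσ₀ ∅ (Finset.empty_subset _)
  obtain ⟨T, hT, -, hTc⟩ := htop ∅ hempty
  have hN : 0 < (HDX.facesCard X (d + 1)).card :=
    Finset.card_pos.2 ⟨T, by simp [HDX.facesCard, hT, hTc]⟩
  have hmem : ∅ ∈ HDX.facesCard X 0 \ HDX.Sbar X (d + 1) (k + 1) (HDX.suppC X f) η k := by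
    rw [Finset.mem_sdiff]
    exact ⟨by simp [HDX.facesCard, hempty], hkey⟩
  unfold HDX.wt
  have hc : ∀ σ ∈ HDX.facesCard X (d + 1), ((((σ.powersetCard 0).filter
      (· ∈ HDX.facesCard X 0 \ HDX.Sbar X (d + 1) (k + 1) (HDX.suppC X f) η k)).card : ℕ) : ℝ)
      = 1 := by
    intro σ _
    rw [Finset.powersetCard_zero, Finset.filter_singleton, if_pos hmem]
    simp
  rw [Finset.sum_congr rfl hc]
  have hN' : ((HDX.facesCard X (d + 1)).card : ℝ) ≠ 0 := by exact_mod_cast hN.ne'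
  simp [hN']
end

section
/- Let X be a d-dimensional λ-local spectral expander, G an abelian group and 0 < η < 1 with λ ≤ η^{2^{d−1}}. For any f ∈ C^k(X;G) with 0 ≤ k ≤ d−1, the set Υ ⊆ X(k+1) of (k+1)-faces that contain two i-faces σ, σ' ∈ S̄_i (for some i) with σ∪σ' ∈ X(i+1) and σ∩σ' ∈ S_{i−1} satisfies ‖Υ‖ ≤ η·C(k+2,2)·2^{k+2}·‖f‖. -/
/- Common framework: weighted simplicial complexes, links, localizations,
   local spectral expansion, cochains, coboundaries, minimality, etc. -/

open Finset

open scoped Classical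

namespace HDX

noncomputable def DD {V : Type*} [Fintype V] [DecidableEq V] (Y : Finset (Finset V)) (t : ℕ)
    (σ : Finset V) : ℝ := (((facesCard Y t).filter (fun τ => σ ⊆ τ)).card : ℝ)

section
variable {V : Type*} [Fintype V] [DecidableEq V]

theorem DD_nonneg (Y : Finset (Finset V)) (t : ℕ) (σ : Finset V) : 0 ≤ DD Y t σ := by
  unfold DD; positivity

theorem DD_eq_sum (Y : Finset (Finset V)) (t : ℕ) (σ : Finset V) :
    DD Y t σ = ∑ τ ∈ facesCard Y t, if σ ⊆ τ then (1:ℝ) else 0 := by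
  unfold DD
  rw [Finset.card_filter]; push_cast; rfl

theorem wt_eq (Y : Finset (Finset V)) (t m : ℕ) (A : Finset (Finset V))
    (hA : ∀ σ ∈ A, σ.card = m) :
    wt Y t m A = (∑ σ ∈ A, DD Y t σ) / (DD Y t ∅ * (t.choose m : ℝ)) := by
  unfold wt
  congr 1
  · simp_rw [DD_eq_sum]
    rw [Finset.sum_comm]
    refine Finset.sum_congr rfl fun T hT => ?_
    rw [← Finset.sum_filter, Finset.sum_const, nsmul_eq_mul, mul_one]
    congr 2
    ext τ
    simp only [mem_filter, mem_powersetCard]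
    constructor
    · rintro ⟨⟨h1, h2⟩, h3⟩; exact ⟨h3, h1⟩
    · rintro ⟨h3, h1⟩; exact ⟨⟨h1, hA _ h3⟩, h3⟩
  · simp [DD]

theorem sum_le_of_cover {α β : Type*} (U : Finset α) (I : Finset β) (g : β → α) (F : α → ℝ)
    (hF : ∀ x, 0 ≤ F x) (h : ∀ x ∈ U, ∃ i ∈ I, g i = x) :
    ∑ x ∈ U, F x ≤ ∑ i ∈ I, F (g i) := by
  rw [← Finset.sum_fiberwise_of_maps_to (s := I) (t := I.image g) (g := g)
    (fun i hi => Finset.mem_image_of_mem _ hi)]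
  refine le_trans (Finset.sum_le_sum_of_subset_of_nonneg (t := I.image g) ?_ ?_) ?_
  · intro x hx
    obtain ⟨i, hi, rfl⟩ := h x hx
    exact Finset.mem_image_of_mem _ hi
  · intros; exact hF _
  · refine Finset.sum_le_sum fun x hx => ?_
    obtain ⟨i, hi, rfl⟩ := Finset.mem_image.1 hx
    exact Finset.single_le_sum (f := fun i => F (g i)) (fun _ _ => hF _) (by simp [hi])

/-- upward counting -/
theorem sum_up (Y : Finset (Finset V)) (t m : ℕ) (σ : Finset V) (hm : σ.card ≤ m) :
    ∑ τ ∈ (Finset.univ : Finset (Finset V)).filter (fun τ => σ ⊆ τ ∧ τ.card = m), DD Y t τ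
      = DD Y t σ * ((t - σ.card).choose (m - σ.card) : ℝ) := by
  simp_rw [DD_eq_sum]
  rw [Finset.sum_comm, Finset.sum_mul]
  refine Finset.sum_congr rfl fun T hT => ?_
  rw [← Finset.sum_filter, Finset.sum_const, nsmul_eq_mul, mul_one]
  have hTc : T.card = t := by
    simp only [facesCard, mem_filter] at hT; exact hT.2
  by_cases hs : σ ⊆ T
  · rw [if_pos hs, one_mul]
    have : (T \ σ).card = t - σ.card := by rw [Finset.card_sdiff_of_subset hs, hTc]
    rw [← this, ← Finset.card_powersetCard]
    congr 1
    refine Finset.card_bij' (fun τ _ => τ \ σ) (fun τ _ => τ ∪ σ) ?_ ?_ ?_ ?_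
    · intro τ hτ
      simp only [mem_filter, mem_univ, true_and] at hτ
      rw [Finset.mem_powersetCard, Finset.card_sdiff_of_subset hτ.1.1, hτ.1.2]
      exact ⟨Finset.sdiff_subset_sdiff hτ.2 le_rfl, rfl⟩
    · intro τ hτ
      rw [Finset.mem_powersetCard] at hτ
      simp only [mem_filter, mem_univ, true_and]
      have hd : Disjoint τ σ := Finset.disjoint_of_subset_left hτ.1 Finset.sdiff_disjoint
      refine ⟨⟨Finset.subset_union_right, ?_⟩, ?_⟩
      · rw [Finset.card_union_of_disjoint hd, hτ.2]; omega
      · exact Finset.union_subset (hτ.1.trans Finset.sdiff_subset) hs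
    · intro τ hτ
      simp only [mem_filter, mem_univ, true_and] at hτ
      exact Finset.sdiff_union_of_subset hτ.1.1
    · intro τ hτ
      rw [Finset.mem_powersetCard] at hτ
      have hd : Disjoint τ σ := Finset.disjoint_of_subset_left hτ.1 Finset.sdiff_disjoint
      rw [Finset.union_sdiff_right]
      exact Finset.sdiff_eq_self_of_disjoint hd
  · rw [if_neg hs, zero_mul]
    norm_cast
    rw [Finset.card_eq_zero, Finset.filter_eq_empty_iff]
    intro τ hτ h
    simp only [mem_filter, mem_univ, true_and] at hτ
    exact hs (hτ.1.trans h)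

theorem DD_link (Y : Finset (Finset V)) (t : ℕ) (ρ e : Finset V) (hρ : ρ.card ≤ t) :
    DD (link Y ρ) (t - ρ.card) e = if Disjoint e ρ then DD Y t (ρ ∪ e) else 0 := by
  split_ifs with hd
  · unfold DD
    congr 1
    refine Finset.card_bij' (fun τ _ => τ ∪ ρ) (fun τ _ => τ \ ρ) ?_ ?_ ?_ ?_
    · intro τ hτ
      simp only [facesCard, link, localize, mem_filter, mem_image] at hτ ⊢
      obtain ⟨⟨⟨T, ⟨hT, hT2⟩, rfl⟩, h2⟩, h3⟩ := hτ
      rw [Finset.sdiff_union_of_subset hT2]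
      rw [Finset.card_sdiff_of_subset hT2] at h2
      have := Finset.card_le_card hT2
      exact ⟨⟨hT, by omega⟩, Finset.union_subset hT2 (h3.trans Finset.sdiff_subset)⟩
    · intro T hT
      simp only [facesCard, link, localize, mem_filter, mem_image] at hT ⊢
      obtain ⟨⟨hT, hc⟩, hs⟩ := hT
      have hs1 := Finset.union_subset_left hs
      have hs2 := Finset.union_subset_right hs
      refine ⟨⟨⟨T, ⟨hT, hs1⟩, rfl⟩, ?_⟩, ?_⟩
      · rw [Finset.card_sdiff_of_subset hs1, hc]
      · exact Finset.subset_sdiff.2 ⟨hs2, hd⟩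
    · intro τ hτ
      simp only [facesCard, link, localize, mem_filter, mem_image] at hτ
      obtain ⟨⟨⟨T, ⟨hT, hT2⟩, rfl⟩, h2⟩, h3⟩ := hτ
      rw [Finset.sdiff_union_of_subset hT2]
    · intro T hT
      simp only [mem_filter] at hT
      exact Finset.sdiff_union_of_subset (Finset.union_subset_left hT.2)
  · unfold DD
    norm_cast
    rw [Finset.card_eq_zero, Finset.filter_eq_empty_iff]
    intro τ hτ h
    simp only [facesCard, link, localize, mem_filter, mem_image] at hτ
    obtain ⟨⟨T, ⟨hT, hT2⟩, rfl⟩, h2⟩ := hτ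
    exact hd (Finset.disjoint_of_subset_left h Finset.sdiff_disjoint)

theorem locWt_eq_s8 (Y : Finset (Finset V)) (t m : ℕ) (B : Finset (Finset V)) (σ : Finset V)
    (hm : m = σ.card + 1) (hB : ∀ τ ∈ B, τ.card = m) (ht : σ.card ≤ t) :
    locWt Y t B m σ = (∑ τ ∈ B.filter (fun τ => σ ⊆ τ), DD Y t τ) /
      (DD Y t σ * ((t - σ.card : ℕ) : ℝ)) := by
  unfold locWt
  rw [wt_eq]
  · rw [DD_link Y t σ ∅ ht, if_pos (Finset.disjoint_empty_left _), Finset.union_empty]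
    have h1 : m - σ.card = 1 := by omega
    rw [h1, Nat.choose_one_right]
    congr 1
    unfold localize
    rw [Finset.sum_image]
    · refine Finset.sum_congr rfl fun τ hτ => ?_
      simp only [mem_filter] at hτ
      rw [DD_link Y t σ _ ht, if_pos Finset.sdiff_disjoint, Finset.union_sdiff_of_subset hτ.2]
    · intro a ha b hb hab
      simp only [coe_filter, Set.mem_ofPred_eq] at ha hb
      simp only at hab
      rw [← Finset.union_sdiff_of_subset ha.2, hab, Finset.union_sdiff_of_subset hb.2]
  · intro e he
    simp only [localize, mem_image, mem_filter] at he
    obtain ⟨τ, ⟨hτ, hs⟩, rfl⟩ := he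
    rw [Finset.card_sdiff_of_subset hs, hB _ hτ]

theorem DD_pos (X : Finset (Finset V)) (d : ℕ) (hXd : IsPureDim X d) (σ : Finset V)
    (hσ : σ ∈ X) : 0 < DD X (d+1) σ := by
  obtain ⟨T, hT, hs, hc⟩ := hXd.2.2 σ hσ
  unfold DD
  norm_cast
  exact Finset.card_pos.2 ⟨T, by simp [facesCard, hT, hs, hc]⟩

theorem mixing (w : V → V → ℝ) (lam ε : ℝ) (hw : ∀ u v, 0 ≤ w u v)
    (hsym : ∀ u v, w u v = w v u) (hexp : IsSpectralExpanderW w lam) (hl : lam ≤ ε)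
    (b : Finset V) (hM : 0 < ∑ u, ∑ v, w u v)
    (hb : ∑ u ∈ b, ∑ v, w u v ≤ ε * ∑ u, ∑ v, w u v) :
    ∑ u ∈ b, ∑ v ∈ b, w u v ≤ 2 * ε * ∑ u ∈ b, ∑ v, w u v := by
  set W : V → ℝ := fun u => ∑ v, w u v with hW
  set M := ∑ u, ∑ v, w u v with hMd
  set P := ∑ u ∈ b, ∑ v, w u v with hP
  set Q := ∑ u ∈ b, ∑ v ∈ b, w u v with hQ
  have hP0 : 0 ≤ P := Finset.sum_nonneg fun u _ => Finset.sum_nonneg fun v _ => hw u v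
  let g : V → ℝ := fun u => if u ∈ b then 1 else 0
  let p := P / M
  have hWg : ∑ u, W u * g u = P := by
    simp [g, W, hP]
  have hWg2 : ∑ u, W u * g u ^ 2 = P := by
    simp [g, W, hP]
  have hWs : ∑ u, W u = M := rfl
  have hwg1 : ∑ u, ∑ v, w u v * g u = P := by
    rw [← hWg]; simp_rw [← Finset.sum_mul]; rfl
  have hwg2 : ∑ u, ∑ v, w u v * g v = P := by
    rw [Finset.sum_comm, ← hwg1]
    refine Finset.sum_congr rfl fun u _ => Finset.sum_congr rfl fun v _ => ?_
    rw [hsym]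
  have hwgg : ∑ u, ∑ v, w u v * g u * g v = Q := by
    simp [g, hQ, Finset.sum_ite_mem]
  have hpM : p * M = P := div_mul_cancel₀ _ hM.ne'
  have key := hexp (fun u => g u - p) (by
    simp_rw [mul_sub]
    rw [Finset.sum_sub_distrib, ← Finset.sum_mul]
    change ∑ u, W u * g u - (∑ u, W u) * p = 0
    rw [hWg, hWs]; linarith)
  have e1 : ∑ u, ∑ v, w u v * (g u - p) * (g v - p) = Q - p * P - p * P + p ^ 2 * M := by
    rw [← hwgg]
    nth_rewrite 1 [← hwg1]
    rw [← hwg2, hMd]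
    simp_rw [Finset.mul_sum, ← Finset.sum_sub_distrib, ← Finset.sum_add_distrib]
    refine Finset.sum_congr rfl fun u _ => Finset.sum_congr rfl fun v _ => ?_
    ring
  have e2 : ∑ u, W u * (g u - p) ^ 2 = P - 2 * p * P + p ^ 2 * M := by
    nth_rewrite 1 [← hWg2]
    rw [← hWg, ← hWs]
    simp_rw [Finset.mul_sum, ← Finset.sum_sub_distrib, ← Finset.sum_add_distrib]
    refine Finset.sum_congr rfl fun u _ => ?_
    ring
  have e3 : 0 ≤ ∑ u, W u * (g u - p) ^ 2 :=
    Finset.sum_nonneg fun u _ => mul_nonneg (Finset.sum_nonneg fun v _ => hw u v) (sq_nonneg _)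
  have k1 := (le_abs_self _).trans key
  rw [e1] at k1
  change _ ≤ lam * ∑ u, W u * (g u - p) ^ 2 at k1
  have k2 := k1.trans (mul_le_mul_of_nonneg_right hl e3)
  rw [e2] at k2
  have hpε : p ≤ ε := by
    rw [div_le_iff₀ hM]; exact hb
  have hp0 : 0 ≤ p := div_nonneg hP0 hM.le
  have hp2 : p ^ 2 * M = p * P := by rw [sq, mul_assoc, hpM]
  rw [hp2] at k2
  nlinarith [mul_le_mul_of_nonneg_right hpε hP0, mul_nonneg (hp0.trans hpε) (mul_nonneg hp0 hP0)]

end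
end HDX
namespace HDX
section
variable {V : Type*} [Fintype V] [DecidableEq V]

noncomputable def EE (Y : Finset (Finset V)) (s : ℕ) (u v : V) : ℝ :=
  if u = v then 0 else DD Y s {u, v}

theorem EE_nonneg (Y : Finset (Finset V)) (s : ℕ) (u v : V) : 0 ≤ EE Y s u v := by
  unfold EE; split_ifs
  · exact le_rfl
  · exact DD_nonneg _ _ _

theorem sum_EE (Y : Finset (Finset V)) (s : ℕ) (hs : 1 ≤ s) (u : V) :
    ∑ v, EE Y s u v = ((s : ℝ) - 1) * DD Y s {u} := by
  have h : ∀ v, EE Y s u v = ∑ T ∈ facesCard Y s, if (v ≠ u ∧ u ∈ T ∧ v ∈ T) then (1:ℝ) else 0 := by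
    intro v
    unfold EE
    split_ifs with h
    · subst h; simp
    · rw [DD_eq_sum]
      refine Finset.sum_congr rfl fun T _ => ?_
      have : ({u, v} : Finset V) ⊆ T ↔ (v ≠ u ∧ u ∈ T ∧ v ∈ T) := by
        rw [Finset.insert_subset_iff, Finset.singleton_subset_iff]
        exact ⟨fun x => ⟨fun e => h e.symm, x⟩, fun x => x.2⟩
      simp only [this]
  simp_rw [h]
  rw [Finset.sum_comm, DD_eq_sum, Finset.mul_sum]
  refine Finset.sum_congr rfl fun T hT => ?_
  have hTc : T.card = s := by
    simp only [facesCard, mem_filter] at hT; exact hT.2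
  rw [← Finset.sum_filter, Finset.sum_const, nsmul_eq_mul, mul_one]
  by_cases hu : u ∈ T
  · have : (Finset.univ.filter fun v => v ≠ u ∧ u ∈ T ∧ v ∈ T) = T.erase u := by
      ext v; simp [hu]
    rw [this, Finset.card_erase_of_mem hu, hTc, if_pos (by simpa using hu), Nat.cast_sub hs]
    simp
  · simp [hu]

theorem sum_single (Y : Finset (Finset V)) (s : ℕ) :
    ∑ u, DD Y s {u} = (s : ℝ) * DD Y s ∅ := by
  simp_rw [DD_eq_sum]
  rw [Finset.sum_comm, Finset.mul_sum]
  refine Finset.sum_congr rfl fun T hT => ?_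
  have hTc : T.card = s := by
    simp only [facesCard, mem_filter] at hT; exact hT.2
  simp [hTc]

theorem edgeWt_eq (Y : Finset (Finset V)) (s : ℕ) (u v : V) :
    edgeWt Y s u v = (DD Y s ∅ * (s.choose 2 : ℝ))⁻¹ * EE Y s u v := by
  unfold edgeWt EE
  by_cases h : u = v
  · simp [h]
  · rw [if_pos h, if_neg h, wt_eq]
    · rw [Finset.sum_singleton, div_eq_inv_mul]
    · intro σ hσ
      rw [Finset.mem_singleton.1 hσ, Finset.card_pair h]

theorem mix2 (Y : Finset (Finset V)) (s : ℕ) (hs : 2 ≤ s) (lam ε : ℝ)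
    (hexp : IsSpectralExpanderW (edgeWt Y s) lam) (hl : lam ≤ ε) (hN : 0 < DD Y s ∅)
    (b : Finset V) (hb : ∑ u ∈ b, DD Y s {u} ≤ ε * (s * DD Y s ∅)) :
    ∑ u ∈ b, ∑ v ∈ b, EE Y s u v ≤ 2 * ε * (((s : ℝ) - 1) * ∑ u ∈ b, DD Y s {u}) := by
  have hc : 0 < (DD Y s ∅ * (s.choose 2 : ℝ))⁻¹ := by
    have : 0 < s.choose 2 := Nat.choose_pos hs
    positivity
  set c := (DD Y s ∅ * (s.choose 2 : ℝ))⁻¹ with hcd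
  have hs1 : (0:ℝ) < (s:ℝ) - 1 := by
    have : (2:ℝ) ≤ s := by exact_mod_cast hs
    linarith
  have hw : edgeWt Y s = fun u v => c * EE Y s u v := by
    funext u v; exact edgeWt_eq Y s u v
  rw [hw] at hexp
  have hdeg : ∀ u, ∑ v, c * EE Y s u v = c * (((s : ℝ) - 1) * DD Y s {u}) := by
    intro u
    rw [← Finset.mul_sum, sum_EE Y s (by omega)]
  have hM : ∑ u, ∑ v, c * EE Y s u v = c * (((s:ℝ) - 1) * (s * DD Y s ∅)) := by
    simp_rw [hdeg]
    rw [← Finset.mul_sum, ← Finset.mul_sum, sum_single]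
  have hP : ∑ u ∈ b, ∑ v, c * EE Y s u v = c * (((s:ℝ) - 1) * ∑ u ∈ b, DD Y s {u}) := by
    simp_rw [hdeg]
    rw [← Finset.mul_sum, ← Finset.mul_sum]
  have hs0 : (0:ℝ) < s := by linarith
  have := mixing (fun u v => c * EE Y s u v) lam ε
    (fun u v => mul_nonneg hc.le (EE_nonneg _ _ _ _))
    (fun u v => by
      simp only [EE]
      rw [Finset.pair_comm]
      by_cases h : u = v
      · simp [h]
      · rw [if_neg h, if_neg (fun e => h e.symm)]) hexp hl b
    (by rw [hM]; positivity)
    (by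
      rw [hM, hP]
      have := mul_le_mul_of_nonneg_left hb (mul_pos hc hs1).le
      linarith)
  rw [hP] at this
  simp_rw [← Finset.mul_sum] at this
  have h2 : c * ∑ u ∈ b, ∑ v ∈ b, EE Y s u v ≤
      c * (2 * ε * (((s : ℝ) - 1) * ∑ u ∈ b, DD Y s {u})) := by linarith
  exact le_of_mul_le_mul_left h2 hc

noncomputable def bb (B : Finset (Finset V)) (ρ : Finset V) : Finset V :=
  Finset.univ.filter fun u => u ∉ ρ ∧ insert u ρ ∈ B

theorem mix3 (X : Finset (Finset V)) (d : ℕ) (hXd : IsPureDim X d) (lam ε : ℝ)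
    (hlse : IsLocalSpectralExpander X d lam) (hl : lam ≤ ε) (m : ℕ) (B : Finset (Finset V))
    (hB : ∀ τ ∈ B, τ.card = m) (ρ : Finset V) (hρ : ρ ∈ X) (hm : m = ρ.card + 1)
    (hmd : m ≤ d) (hthin : locWt X (d+1) B m ρ ≤ ε) :
    ∑ u ∈ bb B ρ, ∑ v ∈ bb B ρ, (if u = v then 0 else DD X (d+1) (ρ ∪ {u, v})) ≤
      2 * ε * (((d:ℝ) + 1 - m) * ∑ τ ∈ B.filter (fun τ => ρ ⊆ τ), DD X (d+1) τ) := by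
  have hDρ := DD_pos X d hXd ρ hρ
  have hle : ρ.card ≤ d + 1 := by omega
  have hN : DD (link X ρ) (d + 1 - ρ.card) ∅ = DD X (d+1) ρ := by
    rw [DD_link X (d+1) ρ ∅ hle, if_pos (Finset.disjoint_empty_left _), Finset.union_empty]
  have hsum : ∑ u ∈ bb B ρ, DD (link X ρ) (d + 1 - ρ.card) {u}
      = ∑ τ ∈ B.filter (fun τ => ρ ⊆ τ), DD X (d+1) τ := by
    refine Finset.sum_bij (fun u _ => insert u ρ) ?_ ?_ ?_ ?_
    · intro u hu
      simp only [bb, mem_filter, mem_univ, true_and] at hu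
      simp [hu.2]
    · intro u hu v hv h
      simp only [bb, mem_filter, mem_univ, true_and] at hu hv
      have : u ∈ insert v ρ := h ▸ Finset.mem_insert_self u ρ
      rcases Finset.mem_insert.1 this with h | h
      · exact h
      · exact absurd h hu.1
    · intro τ hτ
      simp only [mem_filter] at hτ
      have : (τ \ ρ).card = 1 := by
        rw [Finset.card_sdiff_of_subset hτ.2, hB _ hτ.1]; omega
      obtain ⟨u, hu⟩ := Finset.card_eq_one.1 this
      have hu1 : u ∈ τ \ ρ := by rw [hu]; simp
      have e : insert u ρ = τ := by
        rw [Finset.insert_eq, ← hu, Finset.sdiff_union_of_subset hτ.2]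
      refine ⟨u, ?_, e⟩
      simp only [bb, mem_filter, mem_univ, true_and, e]
      exact ⟨(Finset.mem_sdiff.1 hu1).2, hτ.1⟩
    · intro u hu
      simp only [bb, mem_filter, mem_univ, true_and] at hu
      rw [DD_link X (d+1) ρ _ hle, if_pos (by simpa using hu.1), Finset.union_comm,
        ← Finset.insert_eq]
  have hcast : ((d + 1 - ρ.card : ℕ) : ℝ) = (d:ℝ) + 1 - m + 1 := by
    rw [Nat.cast_sub hle, hm]; push_cast; ring
  have hspos : (0:ℝ) < ((d + 1 - ρ.card : ℕ) : ℝ) := by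
    have : 0 < d + 1 - ρ.card := by omega
    exact_mod_cast this
  have := mix2 (link X ρ) (d + 1 - ρ.card) (by omega) lam ε (hlse ρ hρ (by omega)) hl
    (by rw [hN]; exact hDρ) (bb B ρ) (by
      rw [hsum, hN]
      rw [locWt_eq_s8 X (d+1) m B ρ hm hB hle, div_le_iff₀ (mul_pos hDρ hspos)] at hthin
      linarith)
  rw [hsum, hcast] at this
  have e : (d:ℝ) + 1 - m + 1 - 1 = (d:ℝ) + 1 - m := by ring
  rw [e] at this
  refine le_trans (le_of_eq ?_) this
  refine Finset.sum_congr rfl fun u hu => Finset.sum_congr rfl fun v hv => ?_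
  unfold EE
  simp only [bb, mem_filter, mem_univ, true_and] at hu hv
  split_ifs with h
  · rfl
  · rw [DD_link X (d+1) ρ _ hle, if_pos]
    simp [hu.1, hv.1]

/-- counting down by one -/
theorem sum_down (Y : Finset (Finset V)) (t m : ℕ) (B S : Finset (Finset V))
    (hB : ∀ τ ∈ B, τ.card = m + 1) (hS : ∀ σ ∈ S, σ.card = m) :
    ∑ σ ∈ S, ∑ τ ∈ B.filter (fun τ => σ ⊆ τ), DD Y t τ ≤ ((m:ℝ) + 1) * ∑ τ ∈ B, DD Y t τ := by
  simp_rw [Finset.sum_filter]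
  rw [Finset.sum_comm, Finset.mul_sum]
  refine Finset.sum_le_sum fun τ hτ => ?_
  rw [← Finset.sum_filter, Finset.sum_const, nsmul_eq_mul]
  refine mul_le_mul_of_nonneg_right ?_ (DD_nonneg _ _ _)
  have : (S.filter fun σ => σ ⊆ τ).card ≤ m + 1 := by
    calc _ ≤ (τ.powersetCard m).card := Finset.card_le_card (by
            intro σ hσ
            simp only [mem_filter] at hσ
            exact Finset.mem_powersetCard.2 ⟨hσ.2, hS _ hσ.1⟩)
      _ = m + 1 := by rw [Finset.card_powersetCard, hB _ hτ]; simp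
  exact_mod_cast this

theorem choose_step (t m : ℕ) (h : m ≤ t) : (t.choose (m+1) : ℝ) * ((m:ℝ) + 1) =
    t.choose m * ((t:ℝ) - m) := by
  have := Nat.choose_succ_right_eq t m
  rw [← Nat.cast_sub h]
  exact_mod_cast this

/-- fat faces have small weight -/
theorem fat_wt (X : Finset (Finset V)) (d : ℕ) (hXd : IsPureDim X d) (hX0 : ∅ ∈ X) (ε : ℝ)
    (m : ℕ) (hmd : m ≤ d) (B S : Finset (Finset V))
    (hB : ∀ τ ∈ B, τ.card = m + 1) (hSX : ∀ σ ∈ S, σ ∈ X) (hS : ∀ σ ∈ S, σ.card = m)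
    (hfat : ∀ σ ∈ S, ε < locWt X (d+1) B (m+1) σ) :
    ε * wt X (d+1) m S ≤ wt X (d+1) (m+1) B := by
  rw [wt_eq _ _ _ _ hS, wt_eq _ _ _ _ hB]
  have hN := DD_pos X d hXd ∅ hX0
  have hc1 : (0:ℝ) < (d+1).choose m := by exact_mod_cast Nat.choose_pos (by omega)
  have hc2 : (0:ℝ) < (d+1).choose (m+1) := by exact_mod_cast Nat.choose_pos (by omega)
  have hst := choose_step (d+1) m (by omega)
  have hdm : (0:ℝ) < ((d+1:ℕ):ℝ) - m := by
    have : (m:ℝ) < ((d+1:ℕ):ℝ) := by exact_mod_cast (by omega : m < d+1)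
    linarith
  have h1 : (ε * (((d+1:ℕ):ℝ) - m)) * ∑ σ ∈ S, DD X (d+1) σ ≤
      ((m:ℝ) + 1) * ∑ τ ∈ B, DD X (d+1) τ := by
    refine le_trans ?_ (sum_down X (d+1) m B S hB hS)
    rw [Finset.mul_sum]
    refine Finset.sum_le_sum fun σ hσ => ?_
    have hf := hfat σ hσ
    have hD := DD_pos X d hXd σ (hSX σ hσ)
    rw [locWt_eq_s8 X (d+1) (m+1) B σ (by rw [hS σ hσ]) hB (by rw [hS σ hσ]; omega), hS σ hσ,
      Nat.cast_sub (by omega), lt_div_iff₀ (mul_pos hD hdm)] at hf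
    linarith
  rw [← mul_div_assoc, div_le_div_iff₀ (mul_pos hN hc1) (mul_pos hN hc2)]
  have h2 := mul_le_mul_of_nonneg_right h1 (mul_pos hN hc1).le
  have hm1 : (0:ℝ) < (m:ℝ) + 1 := by positivity
  refine le_of_mul_le_mul_left ?_ hm1
  calc _ = ε * (∑ σ ∈ S, DD X (d+1) σ) * DD X (d+1) ∅ * ((d+1).choose (m+1) * ((m:ℝ)+1)) := by
        ring
    _ = ε * (((d+1:ℕ):ℝ) - m) * (∑ σ ∈ S, DD X (d+1) σ) *
          (DD X (d+1) ∅ * (d+1).choose m) := by rw [hst]; ring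
    _ ≤ _ := h2
    _ = _ := by ring

end
end HDX
namespace HDX
section
variable {V : Type*} [Fintype V] [DecidableEq V]

theorem level_sum (X : Finset (Finset V)) (d : ℕ) (hXd : IsPureDim X d) (lam ε : ℝ)
    (hε : 0 ≤ ε) (hlse : IsLocalSpectralExpander X d lam) (hl : lam ≤ ε) (n : ℕ) (hn : n + 1 ≤ d)
    (B R U : Finset (Finset V)) (hB : ∀ τ ∈ B, τ.card = n + 1)
    (hRX : ∀ ρ ∈ R, ρ ∈ X) (hR : ∀ ρ ∈ R, ρ.card = n)
    (hthin : ∀ ρ ∈ R, locWt X (d+1) B (n+1) ρ ≤ ε)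
    (hU : ∀ π ∈ U, ∃ σ ∈ B, ∃ σ' ∈ B, σ ∪ σ' = π ∧ σ ∩ σ' ∈ R) :
    ∑ π ∈ U, DD X (d+1) π ≤
      2 * ε * (((d:ℝ) - n) * (((n:ℝ) + 1) * ∑ τ ∈ B, DD X (d+1) τ)) := by
  have hcov := sum_le_of_cover U
    (R.sigma (fun ρ => ((bb B ρ) ×ˢ (bb B ρ)).filter (fun p => ¬ p.1 = p.2)))
    (fun x => x.1 ∪ {x.2.1, x.2.2}) (DD X (d+1)) (DD_nonneg _ _) (by
      intro π hπ
      obtain ⟨σ, hσ, σ', hσ', rfl, hI⟩ := hU π hπ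
      have key : ∀ α ∈ B, ∀ β : Finset V, α ∩ β ∈ R → ∃ u, u ∉ α ∩ β ∧ insert u (α ∩ β) = α := by
        intro α hα β hαβ
        have h1 : (α \ (α ∩ β)).card = 1 := by
          rw [Finset.card_sdiff_of_subset Finset.inter_subset_left, hB _ hα, hR _ hαβ]; omega
        obtain ⟨u, hu⟩ := Finset.card_eq_one.1 h1
        have hu1 : u ∈ α \ (α ∩ β) := by rw [hu]; simp
        refine ⟨u, (Finset.mem_sdiff.1 hu1).2, ?_⟩
        rw [Finset.insert_eq, ← hu, Finset.sdiff_union_of_subset Finset.inter_subset_left]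
      obtain ⟨u, hu, hu2⟩ := key σ hσ σ' hI
      obtain ⟨v, hv, hv2⟩ := key σ' hσ' σ (by rwa [Finset.inter_comm])
      rw [Finset.inter_comm] at hv hv2
      refine ⟨⟨σ ∩ σ', (u, v)⟩, ?_, ?_⟩
      · simp only [mem_sigma, mem_filter, mem_product, bb, mem_univ, true_and]
        refine ⟨hI, ⟨⟨hu, by rwa [hu2]⟩, ⟨hv, by rwa [hv2]⟩⟩, ?_⟩
        rintro rfl
        rw [hv2] at hu2
        rw [hu2, Finset.inter_self] at hI
        have a := hR _ hI
        have b := hB _ hσ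
        omega
      · change σ ∩ σ' ∪ {u, v} = σ ∪ σ'
        have e : σ ∪ σ' = insert u (σ ∩ σ') ∪ insert v (σ ∩ σ') := by rw [hu2, hv2]
        rw [e]
        ext x
        simp only [Finset.mem_union, Finset.mem_insert, Finset.mem_singleton]
        tauto)
  refine hcov.trans ?_
  rw [Finset.sum_sigma]
  have h1 : ∀ ρ ∈ R, ∑ p ∈ ((bb B ρ) ×ˢ (bb B ρ)).filter (fun p => ¬ p.1 = p.2),
      DD X (d+1) (ρ ∪ {p.1, p.2}) ≤
      2 * ε * (((d:ℝ) - n) * ∑ τ ∈ B.filter (fun τ => ρ ⊆ τ), DD X (d+1) τ) := by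
    intro ρ hρ
    have := mix3 X d hXd lam ε hlse hl (n+1) B hB ρ (hRX ρ hρ) (by rw [hR ρ hρ]) hn (hthin ρ hρ)
    rw [Finset.sum_filter, Finset.sum_product]
    have e : (d:ℝ) + 1 - ((n+1 : ℕ):ℝ) = (d:ℝ) - n := by push_cast; ring
    rw [e] at this
    simp only [ite_not]
    exact this
  refine (Finset.sum_le_sum h1).trans ?_
  rw [← Finset.mul_sum, ← Finset.mul_sum]
  have hdn : (0:ℝ) ≤ (d:ℝ) - n := by
    have : (n:ℝ) ≤ d := by exact_mod_cast (by omega : n ≤ d)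
    linarith
  have := sum_down X (d+1) n B R hB hR
  gcongr

theorem level_wt (X : Finset (Finset V)) (d : ℕ) (hXd : IsPureDim X d) (hX0 : ∅ ∈ X)
    (lam ε : ℝ)
    (hε : 0 ≤ ε) (hlse : IsLocalSpectralExpander X d lam) (hl : lam ≤ ε) (n : ℕ) (hn : n + 1 ≤ d)
    (B R U : Finset (Finset V)) (hB : ∀ τ ∈ B, τ.card = n + 1)
    (hRX : ∀ ρ ∈ R, ρ ∈ X) (hR : ∀ ρ ∈ R, ρ.card = n)
    (hthin : ∀ ρ ∈ R, locWt X (d+1) B (n+1) ρ ≤ ε) (hUc : ∀ π ∈ U, π.card = n + 2)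
    (hU : ∀ π ∈ U, ∃ σ ∈ B, ∃ σ' ∈ B, σ ∪ σ' = π ∧ σ ∩ σ' ∈ R) :
    wt X (d+1) (n+2) U ≤ 2 * ε * ((n:ℝ)+1) * ((n:ℝ)+2) * wt X (d+1) (n+1) B := by
  have h := level_sum X d hXd lam ε hε hlse hl n hn B R U hB hRX hR hthin hU
  rw [wt_eq _ _ _ _ hUc, wt_eq _ _ _ _ hB]
  have hN := DD_pos X d hXd ∅ hX0
  have hc1 : (0:ℝ) < (d+1).choose (n+1) := by exact_mod_cast Nat.choose_pos (by omega)
  have hc2 : (0:ℝ) < (d+1).choose (n+2) := by exact_mod_cast Nat.choose_pos (by omega)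
  have hst := choose_step (d+1) (n+1) (by omega)
  push_cast at hst
  rw [← mul_div_assoc, div_le_div_iff₀ (mul_pos hN hc2) (mul_pos hN hc1)]
  refine (mul_le_mul_of_nonneg_right h (mul_pos hN hc1).le).trans (le_of_eq ?_)
  have e : ((d+1).choose (n+1) : ℝ) * ((d:ℝ) - n) = (d+1).choose (n+2) * ((n:ℝ)+2) := by
    rw [show n + 2 = n + 1 + 1 from rfl]
    linarith
  calc _ = 2 * ε * ((n:ℝ)+1) * (∑ τ ∈ B, DD X (d+1) τ) * DD X (d+1) ∅ *
        (((d+1).choose (n+1) : ℝ) * ((d:ℝ) - n)) := by ring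
    _ = _ := by rw [e]; ring

theorem up_wt (X : Finset (Finset V)) (d : ℕ) (hXd : IsPureDim X d) (hX0 : ∅ ∈ X)
    (l K : ℕ) (hl : l ≤ K) (hK : K ≤ d + 1) (U W : Finset (Finset V))
    (hU : ∀ π ∈ U, π.card = l) (hW : ∀ τ ∈ W, τ.card = K) (h : ∀ τ ∈ W, ∃ π ∈ U, π ⊆ τ) :
    wt X (d+1) K W ≤ (K.choose l : ℝ) * wt X (d+1) l U := by
  have hcov := sum_le_of_cover W
    (U.sigma (fun π => (Finset.univ : Finset (Finset V)).filter (fun τ => π ⊆ τ ∧ τ.card = K)))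
    (fun x => x.2) (DD X (d+1)) (DD_nonneg _ _) (by
      intro τ hτ
      obtain ⟨π, hπ, hs⟩ := h τ hτ
      exact ⟨⟨π, τ⟩, by simp [hπ, hs, hW τ hτ], rfl⟩)
  rw [Finset.sum_sigma] at hcov
  have e : ∑ π ∈ U, ∑ τ ∈ (Finset.univ : Finset (Finset V)).filter (fun τ => π ⊆ τ ∧ τ.card = K),
      DD X (d+1) τ = (∑ π ∈ U, DD X (d+1) π) * ((d + 1 - l).choose (K - l) : ℝ) := by
    rw [Finset.sum_mul]
    refine Finset.sum_congr rfl fun π hπ => ?_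
    rw [sum_up X (d+1) K π (by rw [hU π hπ]; exact hl), hU π hπ]
  have hcov' := hcov.trans (le_of_eq e)
  rw [wt_eq _ _ _ _ hU, wt_eq _ _ _ _ hW]
  have hN := DD_pos X d hXd ∅ hX0
  have hc1 : (0:ℝ) < (d+1).choose K := by exact_mod_cast Nat.choose_pos (by omega)
  have hc2 : (0:ℝ) < (d+1).choose l := by exact_mod_cast Nat.choose_pos (by omega)
  have hch : ((d+1).choose K : ℝ) * K.choose l = (d+1).choose l * (d+1-l).choose (K-l) := by
    exact_mod_cast Nat.choose_mul hl
  rw [← mul_div_assoc, div_le_div_iff₀ (mul_pos hN hc1) (mul_pos hN hc2)]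
  refine (mul_le_mul_of_nonneg_right hcov' (mul_pos hN hc2).le).trans (le_of_eq ?_)
  calc _ = (∑ π ∈ U, DD X (d+1) π) * DD X (d+1) ∅ *
        (((d+1).choose l : ℝ) * (d+1-l).choose (K-l)) := by ring
    _ = _ := by rw [← hch]; ring

theorem Sbar_sub (X : Finset (Finset V)) (t c : ℕ) (A : Finset (Finset V)) (η : ℝ) (r : ℕ) :
    ∀ σ ∈ Sbar X t c A η r, σ ∈ X ∧ σ.card = c - 1 - r := by
  intro σ hσ
  cases r with
  | zero =>
    simp only [Sbar, facesCard, mem_filter] at hσ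
    exact hσ.1
  | succ r =>
    simp only [Sbar, facesCard, mem_filter] at hσ
    exact hσ.1

theorem wt_nonneg (X : Finset (Finset V)) (t m : ℕ) (A : Finset (Finset V)) :
    0 ≤ wt X t m A := by
  unfold wt; positivity

theorem Sbar_wt (X : Finset (Finset V)) (d : ℕ) (hXd : IsPureDim X d) (hX0 : ∅ ∈ X) (η : ℝ)
    (hη : 0 ≤ η) (k : ℕ) (hk : k + 1 ≤ d) (A : Finset (Finset V))
    (hA : ∀ σ ∈ A, σ.card = k + 1) (r : ℕ) (hr : r ≤ k) :
    η ^ (2 ^ (r+1) - 1) * wt X (d+1) (k - r) (Sbar X (d+1) (k+1) A η r) ≤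
      wt X (d+1) (k+1) A := by
  induction r with
  | zero =>
    have := fat_wt X d hXd hX0 η k (by omega) A (Sbar X (d+1) (k+1) A η 0) hA
      (fun σ h => (Sbar_sub _ _ _ _ _ _ σ h).1)
      (fun σ h => by rw [(Sbar_sub _ _ _ _ _ _ σ h).2]; omega)
      (fun σ h => by simp only [Sbar, mem_filter] at h; exact h.2)
    simpa using this
  | succ r ih =>
    refine le_trans ?_ (ih (by omega))
    have e : k - r = (k - (r+1)) + 1 := by omega
    have := fat_wt X d hXd hX0 (η ^ 2 ^ (r+1)) (k - (r+1)) (by omega) (Sbar X (d+1) (k+1) A η r)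
      (Sbar X (d+1) (k+1) A η (r+1))
      (fun σ h => by rw [(Sbar_sub _ _ _ _ _ _ σ h).2]; omega)
      (fun σ h => (Sbar_sub _ _ _ _ _ _ σ h).1)
      (fun σ h => by rw [(Sbar_sub _ _ _ _ _ _ σ h).2]; omega)
      (fun σ h => by
        rw [← e]
        simp only [Sbar, mem_filter] at h
        exact h.2)
    rw [← e] at this
    have h2 : 2 ^ (r+1+1) - 1 = (2 ^ (r+1) - 1) + 2 ^ (r+1) := by
      have : 1 ≤ 2 ^ (r+1) := Nat.one_le_two_pow
      rw [pow_succ 2 (r+1)]; omega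
    rw [h2, pow_add, mul_assoc]
    exact mul_le_mul_of_nonneg_left this (by positivity)

/-- the part of `Υ` coming from level `r` -/
noncomputable def Wr (X : Finset (Finset V)) (t k : ℕ) (A : Finset (Finset V)) (η : ℝ) (r : ℕ) :
    Finset (Finset V) :=
  (facesCard X (k + 2)).filter fun τ => 
    ∃ σ ∈ Sbar X t (k+1) A η r, ∃ σ' ∈ Sbar X t (k+1) A η r, σ ⊆ τ ∧ σ' ⊆ τ ∧
      σ ∪ σ' ∈ facesCard X (k + 1 - r) ∧
      σ ∩ σ' ∈ facesCard X (k + 1 - 2 - r) \ Sbar X t (k+1) A η (r + 1)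

theorem Wr_wt (X : Finset (Finset V)) (d : ℕ) (hXd : IsPureDim X d) (hX0 : ∅ ∈ X) 
    (lam η : ℝ) (hη0 : 0 < η) (hη1 : η < 1) (hlam : lam ≤ η ^ 2 ^ (d - 1))
    (hlse : IsLocalSpectralExpander X d lam)
    (k : ℕ) (hk : k + 1 ≤ d) (A : Finset (Finset V))
    (hA : ∀ σ ∈ A, σ.card = k + 1) (r : ℕ) (hr : r < k) :
    wt X (d+1) (k+2) (Wr X (d+1) k A η r) ≤
      4 * η * (k + 2).choose 2 * k.choose (k - 1 - r) * wt X (d+1) (k+1) A := by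
  obtain ⟨n, rfl⟩ : ∃ n, k = n + 1 + r := ⟨k - 1 - r, by omega⟩
  have e1 : n + 1 + r - 1 - r = n := by omega
  rw [e1]
  have hl : lam ≤ η ^ 2 ^ (r+1) := hlam.trans
    (pow_le_pow_of_le_one hη0.le hη1.le (Nat.pow_le_pow_right (by norm_num) (by omega)))
  let B := Sbar X (d+1) (n+1+r+1) A η r
  let R := facesCard X n \ Sbar X (d+1) (n+1+r+1) A η (r+1)
  let U := (facesCard X (n+2)).filter fun π => ∃ σ ∈ B, ∃ σ' ∈ B, σ ∪ σ' = π ∧ σ ∩ σ' ∈ R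
  have hBc : ∀ σ ∈ B, σ.card = n + 1 := fun σ h => by
    rw [(Sbar_sub _ _ _ _ _ _ σ h).2]; omega
  have hUc : ∀ π ∈ U, π.card = n + 2 := fun π h => by
    simp only [U, facesCard, mem_filter] at h; exact h.1.2
  have h1 := level_wt X d hXd hX0 lam (η ^ 2 ^ (r+1)) (by positivity) hlse hl n (by omega) B R U
    hBc
    (fun ρ h => by simp only [R, facesCard, mem_sdiff, mem_filter] at h; exact h.1.1)
    (fun ρ h => by simp only [R, facesCard, mem_sdiff, mem_filter] at h; exact h.1.2)
    (fun ρ h => by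
      have h' := (Finset.mem_sdiff.1 h).2
      have h'' := (Finset.mem_sdiff.1 h).1
      by_contra hc
      apply h'
      simp only [Sbar, mem_filter]
      have a1 : n + 1 + r + 1 - 1 - (r + 1) = n := by omega
      have a2 : n + 1 + r + 1 - 1 - r = n + 1 := by omega
      rw [a1, a2]
      exact ⟨h'', not_le.1 hc⟩)
    hUc
    (fun π h => by simp only [U, mem_filter] at h; exact h.2)
  have h2 := up_wt X d hXd hX0 (n+2) (n+1+r+2) (by omega) (by omega) U
    (Wr X (d+1) (n+1+r) A η r) hUc
    (fun τ h => by simp only [Wr, facesCard, mem_filter] at h; exact h.1.2)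
    (fun τ h => by
      simp only [Wr, mem_filter] at h
      obtain ⟨_, σ, hσ, σ', hσ', hs, hs', hu, hi⟩ := h
      have a1 : n + 1 + r + 1 - r = n + 2 := by omega
      have a2 : n + 1 + r + 1 - 2 - r = n := by omega
      rw [a1] at hu
      rw [a2] at hi
      refine ⟨σ ∪ σ', ?_, Finset.union_subset hs hs'⟩
      simp only [U, mem_filter]
      exact ⟨hu, σ, hσ, σ', hσ', rfl, hi⟩)
  have h3 := Sbar_wt X d hXd hX0 η hη0.le (n+1+r) hk A hA r (by omega)
  have a3 : n + 1 + r - r = n + 1 := by omega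
  rw [a3] at h3
  have h4 : η ^ 2 ^ (r+1) * wt X (d+1) (n+1) B ≤ η * wt X (d+1) (n+1+r+1) A := by
    have : η ^ 2 ^ (r+1) = η * η ^ (2 ^ (r+1) - 1) := by
      rw [← pow_succ', Nat.sub_add_cancel Nat.one_le_two_pow]
    rw [this, mul_assoc]
    exact mul_le_mul_of_nonneg_left h3 hη0.le
  have hch : ((n+1+r+2).choose (n+2) : ℝ) * (n+2).choose 2 =
      (n+1+r+2).choose 2 * (n+1+r).choose n := by
    have := Nat.choose_mul (n := n+1+r+2) (k := n+2) (s := 2) (by omega)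
    rw [show n+1+r+2-2 = n+1+r by omega, show n+2-2 = n by omega] at this
    exact_mod_cast this
  have hc2 : ((n+2).choose 2 : ℝ) = ((n:ℝ)+2) * ((n:ℝ)+1) / 2 := by
    rw [Nat.cast_choose_two]; push_cast; ring
  calc _ ≤ _ := h2
    _ ≤ ((n+1+r+2).choose (n+2) : ℝ) * (2 * η ^ 2 ^ (r+1) * ((n:ℝ)+1) * ((n:ℝ)+2) *
          wt X (d+1) (n+1) B) := by gcongr
    _ = 4 * (((n+1+r+2).choose (n+2) : ℝ) * (n+2).choose 2) *
          (η ^ 2 ^ (r+1) * wt X (d+1) (n+1) B) := by rw [hc2]; ring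
    _ ≤ 4 * (((n+1+r+2).choose (n+2) : ℝ) * (n+2).choose 2) *
          (η * wt X (d+1) (n+1+r+1) A) := by gcongr
    _ = _ := by rw [hch]; ring

theorem main_bound (X : Finset (Finset V)) (d : ℕ) (hXd : IsPureDim X d) (hX0 : ∅ ∈ X) 
    (lam η : ℝ) (hη0 : 0 < η) (hη1 : η < 1) (hlam : lam ≤ η ^ 2 ^ (d - 1))
    (hlse : IsLocalSpectralExpander X d lam)
    (k : ℕ) (hk : k + 1 ≤ d) (A : Finset (Finset V))
    (hA : ∀ σ ∈ A, σ.card = k + 1) :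
    wt X (d+1) (k+2) (Upsilon X (d+1) (k+1) A η) ≤
      η * ((k + 2).choose 2 : ℝ) * 2 ^ (k + 2) * wt X (d+1) (k+1) A := by
  have hWc : ∀ r, ∀ τ ∈ Wr X (d+1) k A η r, τ.card = k + 2 := fun r τ h => by
    simp only [Wr, facesCard, mem_filter] at h; exact h.1.2
  have h1 : wt X (d+1) (k+2) (Upsilon X (d+1) (k+1) A η) ≤
      ∑ r ∈ Finset.range k, wt X (d+1) (k+2) (Wr X (d+1) k A η r) := by
    rw [wt_eq]
    · simp_rw [fun r => wt_eq X (d+1) (k+2) _ (hWc r)]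
      rw [← Finset.sum_div]
      refine div_le_div_of_nonneg_right ?_ (mul_nonneg (DD_nonneg _ _ _) (by positivity))
      have hcov := sum_le_of_cover (Upsilon X (d+1) (k+1) A η)
        ((Finset.range k).sigma (fun r => Wr X (d+1) k A η r))
        (fun x => x.2) (DD X (d+1)) (DD_nonneg _ _) (by
          intro τ hτ
          simp only [Upsilon, mem_filter] at hτ
          obtain ⟨hf, r, hr, h⟩ := hτ
          refine ⟨⟨r, τ⟩, ?_, rfl⟩
          simp only [mem_sigma, mem_range, Wr, mem_filter]
          exact ⟨by omega, hf, h⟩)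
      rw [Finset.sum_sigma] at hcov
      exact hcov
    · intro τ h
      simp only [Upsilon, facesCard, mem_filter] at h; exact h.1.2
  have h2 : (∑ r ∈ Finset.range k, (k.choose (k - 1 - r) : ℝ)) ≤ 2 ^ k := by
    rw [Finset.sum_range_reflect (fun j => (k.choose j : ℝ))]
    have := Nat.sum_range_choose k
    rw [Finset.sum_range_succ] at this
    have h : ∑ j ∈ Finset.range k, k.choose j ≤ 2 ^ k := by omega
    exact_mod_cast h
  have hw := wt_nonneg X (d+1) (k+1) A
  calc _ ≤ _ := h1
    _ ≤ ∑ r ∈ Finset.range k,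
        4 * η * (k + 2).choose 2 * k.choose (k - 1 - r) * wt X (d+1) (k+1) A :=
      Finset.sum_le_sum fun r hr => Wr_wt X d hXd hX0 lam η hη0 hη1 hlam hlse k hk A hA r
        (Finset.mem_range.1 hr)
    _ = 4 * η * (k + 2).choose 2 * (∑ r ∈ Finset.range k, (k.choose (k - 1 - r) : ℝ)) *
        wt X (d+1) (k+1) A := by rw [Finset.mul_sum, Finset.sum_mul]
    _ ≤ 4 * η * (k + 2).choose 2 * 2 ^ k * wt X (d+1) (k+1) A := by gcongr
    _ = _ := by ring

end
end HDX

/-- in a `d`-dimensional `λ`-local spectral expander with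
`λ ≤ η^(2^(d-1))`, for any `f ∈ C^k(X;G)` (`0 ≤ k ≤ d-1`), the set `Υ ⊆ X(k+1)` of
`(k+1)`-faces containing two `i`-faces `σ, σ' ∈ S̄_i` (for some `i`) with
`σ ∪ σ' ∈ X(i+1)` and `σ ∩ σ' ∈ S_{i-1}` satisfies `‖Υ‖ ≤ η·C(k+2,2)·2^(k+2)·‖f‖`. -/
theorem stmt8 {V : Type*} [Fintype V] [DecidableEq V] {G : Type*} [AddCommGroup G]
    (X : Finset (Finset V)) (d : ℕ) (hX : HDX.IsComplex X) (hXd : HDX.IsPureDim X d)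
    (lam η : ℝ) (hη0 : 0 < η) (hη1 : η < 1) (hlam : lam ≤ η ^ 2 ^ (d - 1))
    (hlse : HDX.IsLocalSpectralExpander X d lam)
    (k : ℕ) (hk : k + 1 ≤ d)
    (f : (Fin (k + 1) → V) → G) (hf : HDX.IsCochain X f) :
    HDX.wt X (d + 1) (k + 2) (HDX.Upsilon X (d + 1) (k + 1) (HDX.suppC X f) η) ≤
      η * ((k + 2).choose 2 : ℝ) * 2 ^ (k + 2) *
        HDX.wt X (d + 1) (k + 1) (HDX.suppC X f) := by
  obtain ⟨σ, hσ⟩ := hXd.1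
  exact HDX.main_bound X d hXd (hX σ hσ ∅ (Finset.empty_subset _)) lam η hη0 hη1 hlam hlse k hk
    (HDX.suppC X f) (fun σ h => by
      simp only [HDX.suppC, HDX.facesCard, Finset.mem_filter] at h
      exact h.1.2)
end

section
/- Let X be a d-dimensional λ-local spectral expander and 0 < η, ε, α < 1 with ε ≤ α/(3d³), λ ≤ ε² and η ≤ ε³. For any A ⊆ X(k) with 1 ≤ k ≤ d−1, if A is (η,ε,α)-weakly-non-local then ‖δ₁(A)‖ ≥ α·‖A‖. -/
/- Common framework: weighted simplicial complexes, links, localizations,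
   local spectral expansion, cochains, coboundaries, minimality, etc. -/

open Finset

open scoped Classical

set_option linter.unusedSectionVars false

namespace HDXP
open HDX

variable {V : Type*} [Fintype V] [DecidableEq V]

noncomputable def D (X : Finset (Finset V)) (t : ℕ) (σ : Finset V) : ℝ :=
  (((facesCard X t).filter (fun T => σ ⊆ T)).card : ℝ)

lemma D_nonneg (X : Finset (Finset V)) (t : ℕ) (σ : Finset V) : 0 ≤ D X t σ := by
  unfold D; positivity

lemma D_eq_sum (X : Finset (Finset V)) (t : ℕ) (σ : Finset V) :
    D X t σ = ∑ T ∈ facesCard X t, if σ ⊆ T then (1 : ℝ) else 0 := by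
  unfold D; simp

lemma D_zero (X : Finset (Finset V)) (t : ℕ) (hX : IsComplex X) (σ : Finset V) (h : σ ∉ X) :
    D X t σ = 0 := by
  unfold D
  simp only [Nat.cast_eq_zero, card_eq_zero, filter_eq_empty_iff]
  intro T hT hs
  exact h (hX T (by simp [facesCard] at hT; exact hT.1) σ hs)

lemma wt_num (Y : Finset (Finset V)) (t m : ℕ) (A : Finset (Finset V)) 
    (hA : ∀ σ ∈ A, σ.card = m) :
    (∑ σ ∈ facesCard Y t, (((σ.powersetCard m).filter (· ∈ A)).card : ℝ)) = ∑ σ ∈ A, D Y t σ := by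
  simp_rw [D_eq_sum]
  rw [Finset.sum_comm]
  refine Finset.sum_congr rfl fun T _ => ?_
  rw [← Finset.sum_filter, Finset.sum_const, nsmul_eq_mul, mul_one]
  congr 2
  ext s
  simp only [mem_filter, mem_powersetCard]
  constructor
  · rintro ⟨⟨h1, h2⟩, h3⟩; exact ⟨h3, h1⟩
  · rintro ⟨h1, h2⟩; exact ⟨⟨h2, hA s h1⟩, h1⟩

lemma wt_mul (Y : Finset (Finset V)) (t m : ℕ) (A : Finset (Finset V)) 
    (hA : ∀ σ ∈ A, σ.card = m) (hN : 0 < (facesCard Y t).card) (hm : m ≤ t) :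
    wt Y t m A * (((facesCard Y t).card : ℝ) * (t.choose m : ℝ)) = ∑ σ ∈ A, D Y t σ := by
  unfold wt
  rw [wt_num Y t m A hA]
  have h1 : (0 : ℝ) < (facesCard Y t).card := by exact_mod_cast hN
  have h2 : (0 : ℝ) < t.choose m := by exact_mod_cast Nat.choose_pos hm
  field_simp

lemma facesCard_link (X : Finset (Finset V)) (t : ℕ) (ρ : Finset V) (hr : ρ.card ≤ t) :
    facesCard (link X ρ) (t - ρ.card) =
      ((facesCard X t).filter (fun T => ρ ⊆ T)).image (fun T => T \ ρ) := by
  ext s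
  simp only [facesCard, link, localize, mem_filter, mem_image]
  constructor
  · rintro ⟨⟨T, ⟨hT, hs⟩, rfl⟩, hc⟩
    refine ⟨T, ⟨⟨hT, ?_⟩, hs⟩, rfl⟩
    rw [card_sdiff_of_subset hs] at hc
    have := card_le_card hs
    omega
  · rintro ⟨T, ⟨⟨hT, hc⟩, hs⟩, rfl⟩
    refine ⟨⟨T, ⟨hT, hs⟩, rfl⟩, ?_⟩
    rw [card_sdiff_of_subset hs, hc]

lemma sdiff_inj (F : Finset (Finset V)) (ρ : Finset V) :
    Set.InjOn (fun T => T \ ρ) (F.filter (fun T => ρ ⊆ T) : Finset (Finset V)) := by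
  intro T hT T' hT' h
  simp only [coe_filter, Set.mem_ofPred_eq] at hT hT' h
  rw [← sdiff_union_of_subset hT.2, ← sdiff_union_of_subset hT'.2, h]

lemma link_N (X : Finset (Finset V)) (t : ℕ) (ρ : Finset V) (hr : ρ.card ≤ t) :
    ((facesCard (link X ρ) (t - ρ.card)).card : ℝ) = D X t ρ := by
  rw [facesCard_link X t ρ hr, card_image_of_injOn (sdiff_inj _ ρ)]; rfl

lemma D_link (X : Finset (Finset V)) (t : ℕ) (ρ s : Finset V) (hr : ρ.card ≤ t) :
    D (link X ρ) (t - ρ.card) s = if Disjoint s ρ then D X t (s ∪ ρ) else 0 := by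
  rw [D_eq_sum, facesCard_link X t ρ hr, sum_image (sdiff_inj _ ρ), sum_filter]
  split_ifs with h
  · rw [D_eq_sum]
    refine sum_congr rfl fun T _ => ?_
    rw [← ite_and]
    congr 1
    simp only [eq_iff_iff, subset_sdiff, union_subset_iff]
    tauto
  · refine sum_eq_zero fun T _ => ?_
    simp only [subset_sdiff]
    simp [h]

lemma locWt_mul (X : Finset (Finset V)) (t m : ℕ) (C : Finset (Finset V)) (ρ : Finset V)
    (hC : ∀ σ ∈ C, σ.card = m) (hr : ρ.card ≤ m) (hm : m ≤ t) (hD : 0 < D X t ρ) :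
    locWt X t C m ρ * (D X t ρ * ((t - ρ.card).choose (m - ρ.card) : ℝ)) =
      ∑ σ ∈ C.filter (fun σ => ρ ⊆ σ), D X t σ := by
  have hN := link_N X t ρ (hr.trans hm)
  unfold locWt
  rw [← hN, wt_mul]
  · unfold localize
    rw [sum_image (sdiff_inj _ ρ)]
    refine sum_congr rfl fun σ hσ => ?_
    rw [D_link X t ρ _ (hr.trans hm), if_pos sdiff_disjoint, sdiff_union_of_subset]
    exact (mem_filter.1 hσ).2
  · intro σ hσ
    simp only [localize, mem_image, mem_filter] at hσ
    obtain ⟨T, ⟨hT, hs⟩, rfl⟩ := hσ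
    rw [card_sdiff_of_subset hs, hC T hT]
  · rw [← hN] at hD; exact_mod_cast hD
  · omega

lemma handshake (X : Finset (Finset V)) (t : ℕ) (σ : Finset V) :
    ∑ u, (if u ∉ σ then D X t (insert u σ) else 0) = ((t : ℝ) - σ.card) * D X t σ := by
  simp_rw [D_eq_sum, mul_sum]
  have : ∀ u, (if u ∉ σ then ∑ T ∈ facesCard X t, (if insert u σ ⊆ T then (1:ℝ) else 0) else 0)
      = ∑ T ∈ facesCard X t, if u ∉ σ ∧ insert u σ ⊆ T then (1:ℝ) else 0 := by
    intro u
    split_ifs with h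
    · simp [h]
    · simp [h]
  simp_rw [this]
  rw [sum_comm]
  refine sum_congr rfl fun T hT => ?_
  rw [← sum_filter, sum_const, nsmul_eq_mul, mul_one]
  split_ifs with h
  · have : (univ.filter fun u => u ∉ σ ∧ insert u σ ⊆ T) = T \ σ := by
      ext u; simp [insert_subset_iff, h, and_comm]
    rw [this, card_sdiff_of_subset h, Nat.cast_sub (card_le_card h)]
    simp only [facesCard, mem_filter] at hT
    rw [hT.2, mul_one]
  · have : (univ.filter fun u => u ∉ σ ∧ insert u σ ⊆ T) = ∅ := by
      ext u; simp [insert_subset_iff, h]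
    rw [this]; simp

/-- sum over superfaces -/
lemma sum_sup (X : Finset (Finset V)) (t m : ℕ) (hX : IsComplex X) (σ : Finset V)
    (hσ : σ.card = m) (P : Finset V → Prop) [DecidablePred P] :
    ∑ τ ∈ (facesCard X (m+1)).filter (fun τ => σ ⊆ τ ∧ P τ), D X t τ =
      ∑ u, if u ∉ σ ∧ P (insert u σ) then D X t (insert u σ) else 0 := by
  rw [← sum_filter]
  have h1 : ∑ u ∈ univ.filter (fun u => u ∉ σ ∧ P (insert u σ)), D X t (insert u σ)
     = ∑ τ ∈ (univ.filter (fun u => u ∉ σ ∧ P (insert u σ))).image (fun u => insert u σ), D X t τ := by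
    rw [sum_image]
    intro u hu v hv h
    simp only [coe_filter, Set.mem_ofPred_eq, mem_univ, true_and] at hu hv h
    have : u ∈ insert v σ := h ▸ mem_insert_self u σ
    rcases mem_insert.1 this with h | h
    · exact h
    · exact absurd h hu.1
  rw [h1]
  apply sum_subset
  · intro τ hτ
    simp only [facesCard, mem_filter, mem_image, mem_univ, true_and] at hτ ⊢
    obtain ⟨⟨hτX, hc⟩, hs, hP⟩ := hτ
    have : (τ \ σ).card = 1 := by rw [card_sdiff_of_subset hs]; omega
    obtain ⟨u, hu⟩ := card_eq_one.1 this
    have hu' : u ∈ τ \ σ := by rw [hu]; simp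
    have he : insert u σ = τ := by
      rw [insert_eq, ← hu, sdiff_union_of_subset hs]
    refine ⟨u, ⟨(mem_sdiff.1 hu').2, by rwa [he]⟩, he⟩
  · intro τ hτ hn
    simp only [facesCard, mem_filter, mem_image, mem_univ, true_and] at hτ hn
    obtain ⟨u, ⟨hu, hP⟩, rfl⟩ := hτ
    apply D_zero X t hX
    intro hc
    exact hn ⟨⟨hc, by rw [card_insert_of_notMem hu, hσ]⟩, subset_insert _ _, hP⟩

lemma sum_sup_all (X : Finset (Finset V)) (t m : ℕ) (hX : IsComplex X) (σ : Finset V)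
    (hσ : σ.card = m) :
    ∑ τ ∈ (facesCard X (m+1)).filter (fun τ => σ ⊆ τ), D X t τ = ((t : ℝ) - m) * D X t σ := by
  have := sum_sup X t m hX σ hσ (fun _ => True)
  simp only [and_true] at this
  rw [this, handshake, hσ]

lemma spectral (w : V → V → ℝ) (lam L : ℝ) (hw : IsSpectralExpanderW w lam) (hL : lam ≤ L)
    (hL0 : 0 ≤ L)
    (hs : ∀ u v, w u v = w v u) (h0 : ∀ u v, 0 ≤ w u v) (P : ℝ) (hP : ∑ u, ∑ v, w u v = P)
    (hP0 : 0 < P) (B : Finset V) :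
    ∑ u ∈ B, ∑ v ∈ B, w u v ≤ (∑ u ∈ B, ∑ v, w u v) * ((∑ u ∈ B, ∑ v, w u v) / P + L) := by
  set S := ∑ u ∈ B, ∑ v, w u v with hS
  set c := S / P with hc
  have hcP : c * P = S := by rw [hc]; field_simp
  have hS0 : 0 ≤ S := sum_nonneg fun u _ => sum_nonneg fun v _ => h0 u v
  let χ : V → ℝ := fun u => if u ∈ B then 1 else 0
  have hS' : ∑ u, (∑ v, w u v) * χ u = S := by
    simp [χ, hS]
  have hE : ∑ u, ∑ v, w u v * χ u * χ v = ∑ u ∈ B, ∑ v ∈ B, w u v := by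
    simp [χ, Finset.sum_ite_mem]
  have hS2 : ∑ u, ∑ v, w u v * χ u = S := by
    rw [← hS']; simp_rw [sum_mul]
  have hS3 : ∑ u, ∑ v, w u v * χ v = S := by
    rw [sum_comm, ← hS2]
    refine sum_congr rfl fun u _ => sum_congr rfl fun v _ => by rw [hs]
  have key := hw (fun u => χ u - c) (by
    simp_rw [mul_sub, sum_sub_distrib, ← sum_mul]
    rw [hS', hP]; linarith)
  have e1 : ∑ u, ∑ v, w u v * (χ u - c) * (χ v - c) = (∑ u ∈ B, ∑ v ∈ B, w u v) - c * S := by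
    have : ∀ u v, w u v * (χ u - c) * (χ v - c) =
      w u v * χ u * χ v - c * (w u v * χ u) - c * (w u v * χ v) + c^2 * w u v := by
      intros; ring
    simp_rw [this, sum_add_distrib, sum_sub_distrib, ← mul_sum]
    rw [hE, hS2, hS3, hP]
    linear_combination c * hcP
  have e2 : ∑ u, (∑ v, w u v) * (χ u - c)^2 = S - c * S := by
    have : ∀ u, (∑ v, w u v) * (χ u - c)^2 = (∑ v, w u v) * χ u - 2 * c * ((∑ v, w u v) * χ u)
       + c^2 * (∑ v, w u v) := by
      intro u
      have : χ u ^ 2 = χ u := by simp only [χ]; split_ifs <;> simp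
      linear_combination (∑ v, w u v) * this
    simp_rw [this, sum_add_distrib, sum_sub_distrib, ← mul_sum]
    rw [hS', hP]
    linear_combination c * hcP
  rw [e1, e2] at key
  have h3 : 0 ≤ S - c * S := by
    rw [← e2]; exact sum_nonneg fun u _ => mul_nonneg (sum_nonneg fun v _ => h0 u v) (sq_nonneg _)
  have h4 : 0 ≤ c * S := mul_nonneg (div_nonneg hS0 hP0.le) hS0
  have h5 := (le_abs_self _).trans key
  have h6 : lam * (S - c * S) ≤ L * (S - c*S) := mul_le_mul_of_nonneg_right hL h3
  have h7 : L * (S - c * S) ≤ L * S := mul_le_mul_of_nonneg_left (by linarith) hL0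
  nlinarith

lemma local_edge (X : Finset (Finset V)) (d r : ℕ) (lam L : ℝ)
    (hlse : IsLocalSpectralExpander X d lam) (hL : lam ≤ L) (hL0 : 0 ≤ L)
    (ρ : Finset V) (hρ : ρ ∈ X) (hr : ρ.card = r) (hrd : r + 2 ≤ d + 1) (hD : 0 < D X (d+1) ρ)
    (B : Finset V) (hB : ∀ u ∈ B, u ∉ ρ) :
    ∑ u ∈ B, ∑ v ∈ B, (if u ≠ v then D X (d+1) (insert u (insert v ρ)) else 0) ≤
      ((d + 1 : ℝ) - r - 1) * (∑ u ∈ B, D X (d+1) (insert u ρ)) *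
        ((∑ u ∈ B, D X (d+1) (insert u ρ)) / (((d + 1 : ℝ) - r) * D X (d+1) ρ) + L) := by
  have hrd' : (r : ℝ) + 2 ≤ d + 1 := by exact_mod_cast hrd
  set t := d + 1 with ht
  let e : V → V → ℝ := fun u v =>
    if u ≠ v ∧ u ∉ ρ ∧ v ∉ ρ then D X t (insert u (insert v ρ)) else 0
  have hC : (0:ℝ) < ((t - r).choose 2 : ℝ) := by
    exact_mod_cast Nat.choose_pos (by omega)
  set K : ℝ := D X t ρ * ((t - r).choose 2 : ℝ) with hK
  have hK0 : 0 < K := mul_pos hD hC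
  have hN := link_N X t ρ (by omega)
  have hew : ∀ u v, e u v = K * edgeWt (link X ρ) (t - ρ.card) u v := by
    intro u v
    unfold edgeWt
    by_cases huv : u = v
    · simp [e, huv]
    · have := wt_mul (link X ρ) (t - ρ.card) 2 {({u, v} : Finset V)} (by
        intro σ hσ; rw [mem_singleton.1 hσ, card_pair huv]) (by
          rw [← hN] at hD; exact_mod_cast hD) (by omega)
      rw [if_pos huv, mul_comm, hK, ← hN]
      rw [hr] at this ⊢
      rw [this, sum_singleton, ← hr, D_link X t ρ _ (by omega)]
      have h2 : ({u, v} : Finset V) ∪ ρ = insert u (insert v ρ) := by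
        ext; simp
      rw [h2]
      simp [e, huv]
  have hspec : IsSpectralExpanderW e lam := by
    have h := hlse ρ hρ (by omega)
    intro f hf
    simp_rw [hew, ← mul_sum, mul_assoc, ← mul_sum] at hf ⊢
    have hf' := (mul_eq_zero.1 hf).resolve_left hK0.ne'
    have := h f hf'
    rw [abs_mul, abs_of_pos hK0]
    simp_rw [mul_assoc] at this
    calc _ ≤ K * (lam * _) := mul_le_mul_of_nonneg_left this hK0.le
      _ = _ := by ring
  have hsum : ∀ u, ∑ v, e u v = if u ∉ ρ then ((d + 1 : ℝ) - r - 1) * D X t (insert u ρ) else 0 := by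
    intro u
    by_cases hu : u ∉ ρ
    · rw [if_pos hu]
      have := handshake X t (insert u ρ)
      rw [card_insert_of_notMem hu, hr] at this
      rw [ht] at this
      push_cast at this
      rw [← ht] at this
      rw [sub_sub, ← this]
      refine sum_congr rfl fun v _ => ?_
      simp only [e, mem_insert, not_or]
      rw [insert_comm v u]
      congr 1
      simp only [eq_iff_iff]
      exact ⟨fun h => ⟨fun h' => h.1 h'.symm, h.2.2⟩, fun h => ⟨fun h' => h.1 h'.symm, hu, h.2⟩⟩
    · rw [if_neg hu]
      refine sum_eq_zero fun v _ => ?_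
      simp only [e]; rw [if_neg]; tauto
  have hP : ∑ u, ∑ v, e u v = ((d + 1 : ℝ) - r - 1) * (((d + 1 : ℝ) - r) * D X t ρ) := by
    have := handshake X t ρ
    rw [hr, ht] at this
    push_cast at this
    rw [← ht] at this
    rw [← this, mul_sum]
    refine sum_congr rfl fun u _ => ?_
    rw [hsum]; split_ifs <;> simp
  have hp1 : (0:ℝ) < (d + 1 : ℝ) - r - 1 := by linarith
  have hp2 : (0:ℝ) < (d + 1 : ℝ) - r := by linarith
  have key := spectral e lam L hspec hL hL0 (by
    intro u v
    simp only [e]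
    rw [insert_comm]
    congr 1
    simp only [eq_iff_iff, ne_eq, eq_comm]
    tauto) (by
    intro u v
    simp only [e]; split_ifs
    · exact D_nonneg _ _ _
    · exact le_rfl) _ hP (mul_pos hp1 (mul_pos hp2 hD)) B
  have hS : ∑ u ∈ B, ∑ v, e u v = ((d + 1 : ℝ) - r - 1) * ∑ u ∈ B, D X t (insert u ρ) := by
    rw [mul_sum]
    refine sum_congr rfl fun u hu => ?_
    rw [hsum, if_pos (hB u hu)]
  have hE : ∑ u ∈ B, ∑ v ∈ B, e u v = 
      ∑ u ∈ B, ∑ v ∈ B, (if u ≠ v then D X t (insert u (insert v ρ)) else 0) := by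
    refine sum_congr rfl fun u hu => sum_congr rfl fun v hv => ?_
    simp only [e, hB u hu, hB v hv, not_false_eq_true, and_true]
  rw [hE, hS, mul_div_mul_left _ _ hp1.ne'] at key
  exact key

lemma acount (C : Finset (Finset V)) (r : ℕ) (τ : Finset V) (hτ : τ.card = r + 2) :
    ((τ.powersetCard (r+1)).filter (· ∈ C)).card = (τ.filter fun u => τ.erase u ∈ C).card := by
  symm
  apply card_bij (fun u _ => τ.erase u)
  · intro u hu
    simp only [mem_filter, mem_powersetCard] at hu ⊢
    exact ⟨⟨erase_subset _ _, by rw [card_erase_of_mem hu.1]; omega⟩, hu.2⟩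
  · intro u hu v hv h
    simp only [mem_filter] at hu hv
    exact (erase_injOn τ) hu.1 hv.1 h
  · intro σ hσ
    simp only [mem_filter, mem_powersetCard] at hσ
    obtain ⟨⟨hs, hc⟩, hC⟩ := hσ
    have : (τ \ σ).card = 1 := by rw [card_sdiff_of_subset hs]; omega
    obtain ⟨u, hu⟩ := card_eq_one.1 this
    have hu' : u ∈ τ \ σ := by rw [hu]; simp
    have he : τ.erase u = σ := by
      rw [← sdiff_singleton_eq_erase, ← hu, Finset.sdiff_sdiff_eq_self hs]
    exact ⟨u, by simp only [mem_filter]; exact ⟨(mem_sdiff.1 hu').1, by rwa [he]⟩, he⟩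

lemma pairs (X : Finset (Finset V)) (t r : ℕ) (hX : IsComplex X) (C : Finset (Finset V)) :
    ∑ τ ∈ facesCard X (r+2), ((((τ.powersetCard (r+1)).filter (· ∈ C)).card : ℝ) *
        ((((τ.powersetCard (r+1)).filter (· ∈ C)).card : ℝ) - 1)) * D X t τ ≤
      ∑ ρ ∈ facesCard X r, ∑ u ∈ univ.filter (fun u => u ∉ ρ ∧ insert u ρ ∈ C),
        ∑ v ∈ univ.filter (fun u => u ∉ ρ ∧ insert u ρ ∈ C),
          if u ≠ v then D X t (insert u (insert v ρ)) else 0 := by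
  have h1 : ∀ τ ∈ facesCard X (r+2), ((((τ.powersetCard (r+1)).filter (· ∈ C)).card : ℝ) *
        ((((τ.powersetCard (r+1)).filter (· ∈ C)).card : ℝ) - 1)) * D X t τ =
      ∑ u, ∑ v, if u ≠ v ∧ (u ∈ τ ∧ τ.erase u ∈ C) ∧ (v ∈ τ ∧ τ.erase v ∈ C) then D X t τ else 0 := by
    intro τ hτ
    have hc : τ.card = r + 2 := (mem_filter.1 hτ).2
    rw [acount C r τ hc]
    set E := τ.filter fun u => τ.erase u ∈ C with hE
    have h2 : ((E.card : ℝ) * ((E.card : ℝ) - 1)) = (E.offDiag.card : ℝ) := by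
      rw [offDiag_card, Nat.cast_sub (Nat.le_mul_self _)]; push_cast; ring
    rw [h2, ← sum_product', ← sum_filter, sum_const, nsmul_eq_mul]
    congr 2
    congr 1
    ext ⟨u, v⟩
    simp [hE, mem_offDiag]
    tauto
  have h3 : ∀ ρ ∈ facesCard X r, (∑ u ∈ univ.filter (fun u => u ∉ ρ ∧ insert u ρ ∈ C),
        ∑ v ∈ univ.filter (fun u => u ∉ ρ ∧ insert u ρ ∈ C),
          if u ≠ v then D X t (insert u (insert v ρ)) else 0) = 
      ∑ u, ∑ v, if u ≠ v ∧ (u ∉ ρ ∧ insert u ρ ∈ C) ∧ (v ∉ ρ ∧ insert v ρ ∈ C) then 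
        D X t (insert u (insert v ρ)) else 0 := by
    intro ρ _
    rw [sum_filter]
    refine sum_congr rfl fun u _ => ?_
    rw [sum_filter]
    split_ifs with h
    · refine sum_congr rfl fun v _ => ?_
      rw [← ite_and]; congr 1; simp only [eq_iff_iff]; tauto
    · symm; apply sum_eq_zero; intro v _; rw [if_neg]; tauto
  rw [sum_congr rfl h1, sum_congr rfl h3, sum_comm]
  rw [sum_comm (s := facesCard X r)]
  refine sum_le_sum fun u _ => ?_
  rw [sum_comm, sum_comm (s := facesCard X r)]
  refine sum_le_sum fun v _ => ?_
  rw [← sum_filter, ← sum_filter]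
  set S := (facesCard X (r+2)).filter
    fun τ => u ≠ v ∧ (u ∈ τ ∧ τ.erase u ∈ C) ∧ (v ∈ τ ∧ τ.erase v ∈ C) with hS
  have hback : ∀ τ ∈ S, insert u (insert v ((τ.erase u).erase v)) = τ := by
    intro τ hτ
    obtain ⟨hτX, huv, ⟨hu, _⟩, hv, _⟩ := mem_filter.1 hτ
    rw [insert_erase (mem_erase.2 ⟨huv.symm, hv⟩), insert_erase hu]
  have hinj : Set.InjOn (fun τ : Finset V => (τ.erase u).erase v) S := by
    intro τ hτ τ' hτ' h
    rw [← hback τ hτ, ← hback τ' hτ']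
    simp only at h
    rw [h]
  calc ∑ τ ∈ S, D X t τ = ∑ τ ∈ S, D X t (insert u (insert v ((τ.erase u).erase v))) :=
        sum_congr rfl fun τ hτ => by rw [hback τ hτ]
    _ = ∑ ρ ∈ S.image (fun τ => (τ.erase u).erase v), D X t (insert u (insert v ρ)) := by
        rw [sum_image hinj]
    _ ≤ _ := by
        apply sum_le_sum_of_subset_of_nonneg
        · intro ρ hρ
          obtain ⟨τ, hτ, rfl⟩ := mem_image.1 hρ
          obtain ⟨hτX, huv, ⟨hu, huC⟩, hv, hvC⟩ := mem_filter.1 hτ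
          obtain ⟨hτX, hc⟩ := mem_filter.1 hτX
          have hv' : v ∈ τ.erase u := mem_erase.2 ⟨huv.symm, hv⟩
          have hu' : u ∈ τ.erase v := mem_erase.2 ⟨huv, hu⟩
          refine mem_filter.2 ⟨mem_filter.2 ⟨hX τ hτX _ ?_, ?_⟩, huv, ⟨?_, ?_⟩, ?_, ?_⟩
          · exact (erase_subset _ _).trans (erase_subset _ _)
          · rw [card_erase_of_mem hv', card_erase_of_mem hu]; omega
          · simp
          · rw [erase_right_comm, insert_erase hu']; exact hvC
          · simp
          · rw [insert_erase hv']; exact huC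
        · intros; exact D_nonneg _ _ _

lemma D_pos (X : Finset (Finset V)) (d : ℕ) (hXd : IsPureDim X d) (σ : Finset V) (h : σ ∈ X) :
    0 < D X (d+1) σ := by
  obtain ⟨T, hT, hs, hc⟩ := hXd.2.2 σ h
  unfold D
  have : T ∈ (facesCard X (d+1)).filter (fun T => σ ⊆ T) := by
    simp [facesCard, hT, hc, hs]
  exact_mod_cast card_pos.2 ⟨T, this⟩

noncomputable def s (X : Finset (Finset V)) (t : ℕ) (C : Finset (Finset V)) (ρ : Finset V) : ℝ :=
  ∑ σ ∈ C.filter (fun σ => ρ ⊆ σ), D X t σ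

lemma s_nonneg (X : Finset (Finset V)) (t : ℕ) (C : Finset (Finset V)) (ρ : Finset V) :
    0 ≤ s X t C ρ := sum_nonneg fun _ _ => D_nonneg _ _ _

noncomputable def E (X : Finset (Finset V)) (t : ℕ) (C : Finset (Finset V)) (ρ : Finset V) : ℝ :=
  ∑ u ∈ univ.filter (fun u => u ∉ ρ ∧ insert u ρ ∈ C),
        ∑ v ∈ univ.filter (fun u => u ∉ ρ ∧ insert u ρ ∈ C),
          if u ≠ v then D X t (insert u (insert v ρ)) else 0

lemma sB (X : Finset (Finset V)) (t r : ℕ) (hX : IsComplex X) (C : Finset (Finset V))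
    (hC : C ⊆ facesCard X (r+1)) (ρ : Finset V) (hr : ρ.card = r) :
    ∑ u ∈ univ.filter (fun u => u ∉ ρ ∧ insert u ρ ∈ C), D X t (insert u ρ) = s X t C ρ := by
  have := sum_sup X t r hX ρ hr (fun τ => τ ∈ C)
  rw [sum_filter, ← this]
  unfold s
  refine sum_congr ?_ fun _ _ => rfl
  ext τ
  simp only [mem_filter]
  constructor
  · rintro ⟨_, h1, h2⟩; exact ⟨h2, h1⟩
  · rintro ⟨h1, h2⟩; exact ⟨hC h1, h2, h1⟩

lemma locWt_s (X : Finset (Finset V)) (d r : ℕ) (hXd : IsPureDim X d)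
    (C : Finset (Finset V)) (hC : C ⊆ facesCard X (r+1))
    (ρ : Finset V) (hρ : ρ ∈ facesCard X r) (hrd : r + 2 ≤ d + 1) :
    locWt X (d+1) C (r+1) ρ * (((d + 1 : ℝ) - r) * D X (d+1) ρ) = s X (d+1) C ρ := by
  obtain ⟨hρX, hr⟩ := mem_filter.1 hρ
  have := locWt_mul X (d+1) (r+1) C ρ (fun σ hσ => (mem_filter.1 (hC hσ)).2) (by omega) (by omega)
    (D_pos X d hXd ρ hρX)
  unfold s
  rw [← this, hr]
  have h1 : r + 1 - r = 1 := by omega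
  rw [h1, Nat.choose_one_right, Nat.cast_sub (by omega)]
  push_cast; ring

lemma E_le (X : Finset (Finset V)) (d r : ℕ) (lam L : ℝ) (hX : IsComplex X) (hXd : IsPureDim X d)
    (hlse : IsLocalSpectralExpander X d lam) (hL : lam ≤ L) (hL0 : 0 ≤ L)
    (C : Finset (Finset V)) (hC : C ⊆ facesCard X (r+1))
    (ρ : Finset V) (hρ : ρ ∈ facesCard X r) (hrd : r + 2 ≤ d + 1) :
    E X (d+1) C ρ ≤ ((d + 1 : ℝ) - r - 1) * s X (d+1) C ρ * (locWt X (d+1) C (r+1) ρ + L) := by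
  obtain ⟨hρX, hr⟩ := mem_filter.1 hρ
  have hD := D_pos X d hXd ρ hρX
  have := local_edge X d r lam L hlse hL hL0 ρ hρX hr hrd hD
    (univ.filter (fun u => u ∉ ρ ∧ insert u ρ ∈ C)) (fun u hu => (mem_filter.1 hu).2.1)
  rw [sB X (d+1) r hX C hC ρ hr] at this
  have hrd' : (r : ℝ) + 2 ≤ d + 1 := by exact_mod_cast hrd
  have h3 : s X (d+1) C ρ / (((d + 1 : ℝ) - r) * D X (d+1) ρ) = locWt X (d+1) C (r+1) ρ := by
    rw [← locWt_s X d r hXd C hC ρ hρ hrd]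
    have : ((d + 1 : ℝ) - r) ≠ 0 := by linarith
    field_simp
  rw [h3] at this
  exact this

lemma E_triv (X : Finset (Finset V)) (d r : ℕ) (C : Finset (Finset V))
    (ρ : Finset V) (hρ : ρ ∈ facesCard X r) (hrd : r + 2 ≤ d + 1) :
    E X (d+1) C ρ ≤ ((d + 1 : ℝ) - r - 1) * (((d + 1 : ℝ) - r) * D X (d+1) ρ) := by
  obtain ⟨hρX, hr⟩ := mem_filter.1 hρ
  have hrd' : (r : ℝ) + 2 ≤ d + 1 := by exact_mod_cast hrd
  have h0 := handshake X (d+1) ρ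
  rw [hr] at h0
  push_cast at h0
  rw [← h0, mul_sum]
  unfold E
  rw [sum_filter]
  refine sum_le_sum fun u _ => ?_
  have hn : 0 ≤ ((d + 1 : ℝ) - r - 1) := by linarith
  by_cases hu : u ∉ ρ
  · rw [if_pos hu]
    have h1 := handshake X (d+1) (insert u ρ)
    rw [card_insert_of_notMem hu, hr] at h1
    push_cast at h1
    rw [sub_sub, ← h1]
    split_ifs with h
    · rw [sum_filter]
      refine sum_le_sum fun v _ => ?_
      by_cases hv : v ∉ insert u ρ
      · rw [if_pos hv, insert_comm]
        split_ifs <;> first | exact le_rfl | exact D_nonneg _ _ _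
      · rw [if_neg hv]
        rw [not_not, mem_insert] at hv
        split_ifs with h5 h6
        · rcases hv with hv | hv
          · exact absurd hv.symm h6
          · exact absurd hv h5.1
        · exact le_rfl
        · exact le_rfl
    · refine sum_nonneg fun v _ => ?_
      split_ifs <;> first | exact le_rfl | exact D_nonneg _ _ _
  · rw [if_neg hu, if_neg (by tauto), mul_zero]

lemma down (X : Finset (Finset V)) (t m : ℕ) (C : Finset (Finset V)) (hC : ∀ σ ∈ C, σ.card = m+1)
    (μ : Finset V) :
    ∑ ρ ∈ (facesCard X m).filter (fun ρ => μ ⊆ ρ), s X t C ρ ≤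
      ((m + 1 : ℝ) - μ.card) * s X t C μ := by
  unfold s
  simp_rw [sum_filter (s := C)]
  rw [sum_comm, mul_sum]
  refine sum_le_sum fun σ hσ => ?_
  split_ifs with h
  · rw [← sum_filter, sum_const, nsmul_eq_mul]
    refine mul_le_mul_of_nonneg_right ?_ (D_nonneg _ _ _)
    have hc := hC σ hσ
    have h1 : ((facesCard X m).filter (fun ρ => μ ⊆ ρ)).filter (fun ρ => ρ ⊆ σ) ⊆
        (σ \ μ).image (fun u => σ.erase u) := by
      intro ρ hρ
      simp only [facesCard, mem_filter] at hρ
      obtain ⟨⟨⟨_, hm⟩, hμ⟩, hs⟩ := hρ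
      have : (σ \ ρ).card = 1 := by rw [card_sdiff_of_subset hs]; omega
      obtain ⟨u, hu⟩ := card_eq_one.1 this
      have hu' : u ∈ σ \ ρ := by rw [hu]; simp
      have he : σ.erase u = ρ := by
        rw [← sdiff_singleton_eq_erase, ← hu, Finset.sdiff_sdiff_eq_self hs]
      refine mem_image.2 ⟨u, ?_, he⟩
      rw [mem_sdiff] at hu' ⊢
      exact ⟨hu'.1, fun h => hu'.2 (hμ h)⟩
    have h2 := (card_le_card h1).trans card_image_le
    rw [card_sdiff_of_subset h, hc] at h2
    have h3 : μ.card ≤ m + 1 := hc ▸ card_le_card h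
    calc _ ≤ ((m + 1 - μ.card : ℕ) : ℝ) := by exact_mod_cast h2
      _ = _ := by rw [Nat.cast_sub h3]; push_cast; ring
  · rw [mul_zero]
    apply le_of_eq
    refine sum_eq_zero fun ρ hρ => ?_
    rw [if_neg]
    exact fun h' => h ((mem_filter.1 hρ).2.trans h')

lemma down0 (X : Finset (Finset V)) (t m : ℕ) (C : Finset (Finset V)) (hC : ∀ σ ∈ C, σ.card = m+1) :
    ∑ ρ ∈ facesCard X m, s X t C ρ ≤ (m + 1 : ℝ) * ∑ σ ∈ C, D X t σ := by
  have := down X t m C hC ∅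
  simpa [s] using this

lemma cnt (C : Finset (Finset V)) (m : ℕ) (hC : ∀ σ ∈ C, σ.card = m) (τ : Finset V) :
    (((τ.powersetCard m).filter (· ∈ C)).card : ℝ) = ∑ σ ∈ C, if σ ⊆ τ then (1:ℝ) else 0 := by
  rw [← sum_filter, sum_const, nsmul_eq_mul, mul_one]
  congr 2
  ext σ
  simp only [mem_filter, mem_powersetCard]
  exact ⟨fun h => ⟨h.2, h.1.1⟩, fun h => ⟨⟨h.2, hC σ h.1⟩, h.1⟩⟩

lemma sum_cnt_D (X : Finset (Finset V)) (t m : ℕ) (F C : Finset (Finset V))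
    (hF : ∀ σ ∈ F, σ.card = m) :
    ∑ σ ∈ C, (((σ.powersetCard m).filter (· ∈ F)).card : ℝ) * D X t σ = ∑ ρ ∈ F, s X t C ρ := by
  unfold s
  simp_rw [cnt F m hF, sum_mul, sum_filter]
  rw [sum_comm]
  simp

lemma sum_all (X : Finset (Finset V)) (t m : ℕ) (hX : IsComplex X) :
    ∑ σ ∈ facesCard X m, D X t σ = ((facesCard X t).card : ℝ) * (t.choose m : ℝ) := by
  rw [← wt_num X t m (facesCard X m) (fun σ hσ => (mem_filter.1 hσ).2)]
  rw [← nsmul_eq_mul, ← sum_const]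
  refine sum_congr rfl fun T hT => ?_
  obtain ⟨h1, h2⟩ := mem_filter.1 hT
  rw [filter_true_of_mem, card_powersetCard, h2]
  intro σ hσ
  obtain ⟨h3, h4⟩ := mem_powersetCard.1 hσ
  exact mem_filter.2 ⟨hX T h1 σ h3, h4⟩

lemma choose_cast (n m : ℕ) (h : m ≤ n) :
    (n.choose (m+1) : ℝ) * (m + 1) = (n.choose m : ℝ) * ((n : ℝ) - m) := by
  have := Nat.choose_succ_right_eq n m
  rw [← Nat.cast_sub h]
  exact_mod_cast this

lemma fat_bound (X : Finset (Finset V)) (d j : ℕ) (ε : ℝ) (hXd : IsPureDim X d)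
    (hj : j + 2 ≤ d) (A : Finset (Finset V)) (hA : A ⊆ facesCard X (j+2)) (ρ : Finset V)
    (hρ : ρ ∈ (facesCard X (j+1)).filter (fun ρ => ε < locWt X (d+1) A (j+2) ρ)) :
    ε * ((d : ℝ) - j) * D X (d+1) ρ ≤ s X (d+1) A ρ := by
  obtain ⟨hρ, h⟩ := mem_filter.1 hρ
  have h1 := locWt_s X d (j+1) hXd A hA ρ hρ (by omega)
  have hD := D_nonneg X (d+1) ρ
  have hj' : (j : ℝ) + 2 ≤ d := by exact_mod_cast hj
  rw [← h1]
  push_cast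
  have : 0 ≤ ((d:ℝ) - j) * D X (d+1) ρ := mul_nonneg (by linarith) hD
  calc ε * ((d : ℝ) - j) * D X (d+1) ρ = ε * (((d:ℝ) - j) * D X (d+1) ρ) := by ring
    _ ≤ locWt X (d+1) A (j+2) ρ * (((d:ℝ) - j) * D X (d+1) ρ) :=
      mul_le_mul_of_nonneg_right h.le this
    _ = _ := by ring

lemma stepQ (X : Finset (Finset V)) (d j : ℕ) (lam η ε : ℝ) (hX : IsComplex X)
    (hXd : IsPureDim X d)
    (hlse : IsLocalSpectralExpander X d lam) (hε0 : 0 < ε) (hlamε : lam ≤ ε ^ 2)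
    (hηε : η ≤ ε ^ 3) (hj : j + 2 ≤ d)
    (A : Finset (Finset V)) (hA : A ⊆ facesCard X (j + 2))
    (hw : wt X (d+1) j ((facesCard X j).filter fun σ => locWt X (d+1) A (j+2) σ ≤ η) ≥
      1 - ε * wt X (d+1) (j+2) A) :
    ∑ μ ∈ facesCard X j, 
      E X (d+1) ((facesCard X (j+1)).filter (fun ρ => ε < locWt X (d+1) A (j+2) ρ)) μ ≤
      3 * ε * (j+1) * (j+2) * ∑ σ ∈ A, D X (d+1) σ := by
  set F := (facesCard X (j+1)).filter (fun ρ => ε < locWt X (d+1) A (j+2) ρ) with hF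
  set W := ∑ σ ∈ A, D X (d+1) σ with hW
  have hAc : ∀ σ ∈ A, σ.card = j + 2 := fun σ hσ => (mem_filter.1 (hA hσ)).2
  have hFs : F ⊆ facesCard X (j+1) := filter_subset _ _
  have hj' : (j : ℝ) + 2 ≤ d := by exact_mod_cast hj
  have hj0 : (0:ℝ) ≤ j := Nat.cast_nonneg j
  set R : ℝ := (d:ℝ) - j with hR
  have hR2 : 2 ≤ R := by linarith
  have hN : 0 < (facesCard X (d+1)).card := by
    obtain ⟨σ, hσ⟩ := hXd.1
    obtain ⟨T, hT, _, hc⟩ := hXd.2.2 σ hσ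
    exact card_pos.2 ⟨T, mem_filter.2 ⟨hT, hc⟩⟩
  set G := (facesCard X j).filter fun σ => locWt X (d+1) A (j+2) σ ≤ η with hG
  -- good faces
  have hgood : ∀ μ ∈ G, E X (d+1) F μ ≤ R * (2 * ε^2) * s X (d+1) F μ := by
    intro μ hμ
    obtain ⟨hμX, hμη⟩ := mem_filter.1 hμ
    obtain ⟨hμX', hμc⟩ := mem_filter.1 hμX
    have hD := D_pos X d hXd μ hμX'
    have h1 := E_le X d j lam (ε^2) hX hXd hlse hlamε (sq_nonneg _) F hFs μ hμX (by omega)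
    have hs0 := s_nonneg X (d+1) F μ
    have hb : locWt X (d+1) F (j+1) μ ≤ ε^2 := by
      have e1 := locWt_s X d j hXd F hFs μ hμX (by omega)
      have e2 := locWt_mul X (d+1) (j+2) A μ hAc (by omega) (by omega) hD
      have e3 : j + 2 - μ.card = 2 := by omega
      rw [e3, Nat.cast_choose_two, hμc, Nat.cast_sub (by omega)] at e2
      push_cast at e2
      have e4 := down X (d+1) (j+1) A hAc μ
      rw [hμc] at e4
      push_cast at e4
      have e5 : ε * R * s X (d+1) F μ ≤ 2 * s X (d+1) A μ := by
        calc ε * R * s X (d+1) F μ = ∑ ρ ∈ F.filter (fun ρ => μ ⊆ ρ), ε * R * D X (d+1) ρ := by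
              rw [s, mul_sum]
          _ ≤ ∑ ρ ∈ F.filter (fun ρ => μ ⊆ ρ), s X (d+1) A ρ := 
              sum_le_sum fun ρ hρ => fat_bound X d j ε hXd hj A hA ρ (mem_filter.1 hρ).1
          _ ≤ ∑ ρ ∈ (facesCard X (j+1)).filter (fun ρ => μ ⊆ ρ), s X (d+1) A ρ := by
              apply sum_le_sum_of_subset_of_nonneg
              · exact filter_subset_filter _ hFs
              · intros; exact s_nonneg _ _ _ _
          _ ≤ _ := e4
          _ = _ := by ring
      change _ = s X (d+1) A μ at e2
      have hRp : 0 < (R + 1) * R * D X (d+1) μ := by positivity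
      have e6 : ε * locWt X (d+1) F (j+1) μ * ((R + 1) * R * D X (d+1) μ) ≤
          locWt X (d+1) A (j+2) μ * ((R + 1) * R * D X (d+1) μ) := by
        rw [← e1, ← e2] at e5
        have a1 : (d:ℝ) + 1 - j = R + 1 := by rw [hR]; ring
        rw [a1] at e5
        linarith
      have e7 := le_of_mul_le_mul_right e6 hRp
      have e8 : ε * locWt X (d+1) F (j+1) μ ≤ ε * ε^2 := by
        calc _ ≤ _ := e7
          _ ≤ _ := hμη
          _ ≤ _ := hηε
          _ = _ := by ring
      exact le_of_mul_le_mul_left e8 hε0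
    calc _ ≤ _ := h1
      _ ≤ ((d + 1 : ℝ) - j - 1) * s X (d+1) F μ * (ε^2 + ε^2) := by
        apply mul_le_mul_of_nonneg_left (by linarith)
        exact mul_nonneg (by linarith) hs0
      _ = _ := by rw [hR]; ring
  have hbad : ∀ μ ∈ facesCard X j \ G, E X (d+1) F μ ≤ R * (R+1) * D X (d+1) μ := by
    intro μ hμ
    have := E_triv X d j F μ (mem_sdiff.1 hμ).1 (by omega)
    refine this.trans (le_of_eq ?_)
    rw [hR]; ring
  -- sums
  have hS1 : ε * R * ∑ μ ∈ G, s X (d+1) F μ ≤ (j+1) * (j+2) * W := by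
    have f1 : ∑ μ ∈ G, s X (d+1) F μ ≤ (j + 1 : ℝ) * ∑ ρ ∈ F, D X (d+1) ρ := by
      refine (sum_le_sum_of_subset_of_nonneg (filter_subset _ _) ?_).trans 
        (down0 X (d+1) j F fun ρ hρ => (mem_filter.1 (hFs hρ)).2)
      intros; exact s_nonneg _ _ _ _
    have f2 : ε * R * ∑ ρ ∈ F, D X (d+1) ρ ≤ (j+2) * W := by
      rw [mul_sum]
      calc _ ≤ ∑ ρ ∈ F, s X (d+1) A ρ := sum_le_sum fun ρ hρ => fat_bound X d j ε hXd hj A hA ρ hρ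
        _ ≤ ∑ ρ ∈ facesCard X (j+1), s X (d+1) A ρ := 
          sum_le_sum_of_subset_of_nonneg hFs fun _ _ _ => s_nonneg _ _ _ _
        _ ≤ _ := down0 X (d+1) (j+1) A hAc
        _ = _ := by push_cast; ring
    calc _ ≤ ε * R * ((j + 1 : ℝ) * ∑ ρ ∈ F, D X (d+1) ρ) :=
          mul_le_mul_of_nonneg_left f1 (by positivity)
      _ = (j+1) * (ε * R * ∑ ρ ∈ F, D X (d+1) ρ) := by ring
      _ ≤ (j+1) * ((j+2) * W) := mul_le_mul_of_nonneg_left f2 (by positivity)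
      _ = _ := by ring
  have hS2 : R * (R+1) * ∑ μ ∈ facesCard X j \ G, D X (d+1) μ ≤ ε * (j+1) * (j+2) * W := by
    have g1 := wt_mul X (d+1) j G (fun σ hσ => (mem_filter.1 (mem_filter.1 hσ).1).2) hN (by omega)
    have g2 := wt_mul X (d+1) (j+2) A hAc hN (by omega)
    have g3 := sum_all X (d+1) j hX
    have g4 := sum_sdiff (f := D X (d+1)) (show G ⊆ facesCard X j from filter_subset _ _)
    have c1 := choose_cast (d+1) j (by omega)
    have c2 := choose_cast (d+1) (j+1) (by omega)
    push_cast at c1 c2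
    set N : ℝ := ((facesCard X (d+1)).card : ℝ)
    set c := ((d+1).choose j : ℝ)
    have hNc : 0 ≤ N * c := by positivity
    have g5 : ∑ μ ∈ facesCard X j \ G, D X (d+1) μ ≤ ε * wt X (d+1) (j+2) A * (N * c) := by
      have : (1 - ε * wt X (d+1) (j+2) A) * (N * c) ≤ wt X (d+1) j G * (N * c) :=
        mul_le_mul_of_nonneg_right hw hNc
      linarith
    have g6 : c * (R + 1) * R = ((d+1).choose (j+2) : ℝ) * (j+1) * (j+2) := by
      rw [hR]
      linear_combination (-(d - j : ℝ)) * c1 - (j+1) * c2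
    calc _ ≤ R * (R+1) * (ε * wt X (d+1) (j+2) A * (N * c)) :=
          mul_le_mul_of_nonneg_left g5 (by positivity)
      _ = ε * (j+1) * (j+2) * W := by
        rw [hW, ← g2]
        linear_combination (ε * wt X (d+1) (j+2) A * N) * g6
  rw [← sum_sdiff (show G ⊆ facesCard X j from filter_subset _ _)]
  have t1 := sum_le_sum hgood
  have t2 := sum_le_sum hbad
  rw [← mul_sum] at t1 t2
  have t3 : 2 * ε * (ε * R * ∑ μ ∈ G, s X (d+1) F μ) ≤ 2 * ε * ((j+1) * (j+2) * W) :=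
    mul_le_mul_of_nonneg_left hS1 (by positivity)
  linarith

end HDXP

lemma HDXP.wt_nonneg {V : Type*} [Fintype V] [DecidableEq V] (Y : Finset (Finset V)) (t m : ℕ)
    (A : Finset (Finset V)) : 0 ≤ HDX.wt Y t m A := by
  unfold HDX.wt; positivity

lemma HDXP.numeric (j d ε α : ℝ) (hj0 : 0 ≤ j) (hj' : j + 2 ≤ d) (hε0 : 0 < ε) (hε1 : ε < 1)
    (hα0 : 0 < α) (hεα : ε ≤ α / (3 * d ^ 3)) :
    α ≤ (j + 3) * (1 - ((1 - α) * (1 + 1 / 2 * (3 * ε * (j+1) * (j+2))) 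
        + (ε + ε^2) * (j+2))) := by
    set m : ℝ := (j:ℝ) + 2 with hm
    have hm2 : 2 ≤ m := by linarith
    have hεm : 3 * m^3 * ε ≤ α := by
      have hdp : (0:ℝ) < d := by linarith
      rw [le_div_iff₀ (by positivity)] at hεα
      have : m^3 ≤ (d:ℝ)^3 := by gcongr
      nlinarith [mul_le_mul_of_nonneg_left this hε0.le]
    have e1 : (j:ℝ) + 3 = m + 1 := by rw [hm]; ring
    have e2 : (j:ℝ) + 1 = m - 1 := by rw [hm]; ring
    rw [e1, e2]
    have hε2 : ε^2 ≤ ε := by nlinarith only [hε0, hε1]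
    -- error bound
    have e3 : 1 / 2 * (3 * ε * (m - 1) * m) + (ε + ε^2) * m ≤ 3 / 2 * m^2 * ε + 1 / 2 * m * ε := by
      nlinarith only [mul_le_mul_of_nonneg_right hε2 (show 0 ≤ m by linarith)]
    have e4 : (1 - α) * (1 / 2 * (3 * ε * (m - 1) * m)) ≤ 1 / 2 * (3 * ε * (m - 1) * m) := by
      have : 0 ≤ 1 / 2 * (3 * ε * (m - 1) * m) := by
        have : 0 ≤ m - 1 := by linarith
        positivity
      nlinarith only [this, mul_nonneg hα0.le this]
    have e5 : (m + 1) * (3 / 2 * m^2 * ε + 1 / 2 * m * ε) ≤ 3 * m^3 * ε * m := by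
      have a : 2 * m ≤ m^2 := by nlinarith only [hm2]
      have b : 2 * m^2 ≤ m^3 := by nlinarith only [hm2, mul_nonneg (sq_nonneg m) (sub_nonneg.2 hm2)]
      have b0 : 0 ≤ m^3 := by positivity
      have c : 2 * m^3 ≤ m^3 * m := by nlinarith only [mul_nonneg b0 (sub_nonneg.2 hm2)]
      have : (m + 1) * (3 / 2 * m^2 + 1 / 2 * m) ≤ 3 * m^3 * m := by
        nlinarith only [a, b, c, hm2]
      nlinarith only [mul_le_mul_of_nonneg_right this hε0.le]
    have e6 : 3 * m^3 * ε * m ≤ α * m := mul_le_mul_of_nonneg_right hεm (by linarith)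
    have e7 : 1 - ((1 - α) * (1 + 1 / 2 * (3 * ε * (m-1) * m)) + (ε + ε^2) * m) ≥
      α - (3 / 2 * m^2 * ε + 1 / 2 * m * ε) := by linarith
    have e8 := mul_le_mul_of_nonneg_left e7 (show 0 ≤ m + 1 by linarith)
    linarith

set_option maxHeartbeats 1000000 in
/-- Weakly-non-local sets are δ₁-expanding: in a `d`-dimensional
`λ`-local spectral expander, with `ε ≤ α/(3d³)`, `λ ≤ ε²` and `η ≤ ε³`, any
`(η,ε,α)`-weakly-non-local `A ⊆ X(k)` (`1 ≤ k ≤ d-1`) satisfies `‖δ₁(A)‖ ≥ α‖A‖`. -/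
theorem stmt10 {V : Type*} [Fintype V] [DecidableEq V]
    (X : Finset (Finset V)) (d : ℕ) (lam η ε α : ℝ)
    (hX : HDX.IsComplex X) (hXd : HDX.IsPureDim X d)
    (hlse : HDX.IsLocalSpectralExpander X d lam)
    (hη0 : 0 < η) (hη1 : η < 1) (hε0 : 0 < ε) (hε1 : ε < 1) (hα0 : 0 < α) (hα1 : α < 1)
    (hεα : ε ≤ α / (3 * (d : ℝ) ^ 3)) (hlamε : lam ≤ ε ^ 2) (hηε : η ≤ ε ^ 3)
    (k : ℕ) (hk1 : 1 ≤ k) (hk : k + 1 ≤ d)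
    (A : Finset (Finset V)) (hA : A ⊆ HDX.facesCard X (k + 1))
    (hwnl : HDX.IsWeaklyNonlocal X (d + 1) k A η ε α) :
    HDX.wt X (d + 1) (k + 2) (HDX.delta1 X (k + 1) A) ≥
      α * HDX.wt X (d + 1) (k + 1) A := by
  obtain ⟨j, rfl⟩ : ∃ j, k = j + 1 := ⟨k - 1, by omega⟩
  obtain ⟨hw1, hw2⟩ := hwnl
  have hQ := HDXP.stepQ X d j lam η ε hX hXd hlse hε0 hlamε hηε (by omega) A hA hw1
  set F := (HDX.facesCard X (j+1)).filter (fun ρ => ε < HDX.locWt X (d+1) A (j+2) ρ) with hF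
  set W := ∑ σ ∈ A, HDXP.D X (d+1) σ with hW
  have hW0 : 0 ≤ W := sum_nonneg fun _ _ => HDXP.D_nonneg _ _ _
  have hAc : ∀ σ ∈ A, σ.card = j + 2 := fun σ hσ => (mem_filter.1 (hA hσ)).2
  have hFs : F ⊆ HDX.facesCard X (j+1) := filter_subset _ _
  have hFc : ∀ σ ∈ F, σ.card = j + 1 := fun σ hσ => (mem_filter.1 (hFs hσ)).2
  have hj' : (j : ℝ) + 2 ≤ d := by exact_mod_cast hk
  have hj0 : (0:ℝ) ≤ j := Nat.cast_nonneg j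
  have hN : 0 < (HDX.facesCard X (d+1)).card := by
    obtain ⟨σ, hσ⟩ := hXd.1
    obtain ⟨T, hT, _, hc⟩ := hXd.2.2 σ hσ
    exact card_pos.2 ⟨T, mem_filter.2 ⟨hT, hc⟩⟩
  -- fat sum
  have hfat : ∑ ρ ∈ F, HDXP.s X (d+1) A ρ ≤ W + 1 / 2 * (3 * ε * (j+1) * (j+2) * W) := by
    have p1 := (HDXP.pairs X (d+1) j hX F).trans hQ
    rw [← HDXP.sum_cnt_D X (d+1) (j+1) F A hFc]
    have p2 : ∀ n : ℕ, (n : ℝ) ≤ 1 + 1 / 2 * (n * ((n : ℝ) - 1)) := by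
      intro n
      have : (0:ℝ) ≤ ((n:ℝ) - 1) * ((n:ℝ) - 2) := by
        rcases Nat.lt_or_ge n 2 with h | h
        · interval_cases n <;> norm_num
        · have : (2:ℝ) ≤ n := by exact_mod_cast h
          exact mul_nonneg (by linarith) (by linarith)
      linarith
    have p3 : ∀ n : ℕ, (0:ℝ) ≤ n * ((n:ℝ) - 1) := by
      intro n
      rcases Nat.eq_zero_or_pos n with h | h
      · simp [h]
      · have : (1:ℝ) ≤ n := by exact_mod_cast h
        exact mul_nonneg (by linarith) (by linarith)
    calc _ ≤ ∑ σ ∈ A, (HDXP.D X (d+1) σ + 1 / 2 *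
          (((((σ.powersetCard (j+1)).filter (· ∈ F)).card : ℝ) *
        ((((σ.powersetCard (j+1)).filter (· ∈ F)).card : ℝ) - 1)) * HDXP.D X (d+1) σ)) := by
          refine sum_le_sum fun σ _ => ?_
          have := mul_le_mul_of_nonneg_right (p2 ((σ.powersetCard (j+1)).filter (· ∈ F)).card)
            (HDXP.D_nonneg X (d+1) σ)
          linarith
      _ = W + 1 / 2 * ∑ σ ∈ A, (((((σ.powersetCard (j+1)).filter (· ∈ F)).card : ℝ) *
        ((((σ.powersetCard (j+1)).filter (· ∈ F)).card : ℝ) - 1)) * HDXP.D X (d+1) σ) := by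
          rw [sum_add_distrib, ← mul_sum]
      _ ≤ W + 1 / 2 * ∑ σ ∈ HDX.facesCard X (j+2),
            (((((σ.powersetCard (j+1)).filter (· ∈ F)).card : ℝ) *
        ((((σ.powersetCard (j+1)).filter (· ∈ F)).card : ℝ) - 1)) * HDXP.D X (d+1) σ) := by
          have := sum_le_sum_of_subset_of_nonneg (f := fun σ => 
            (((((σ.powersetCard (j+1)).filter (· ∈ F)).card : ℝ) *
            ((((σ.powersetCard (j+1)).filter (· ∈ F)).card : ℝ) - 1)) * HDXP.D X (d+1) σ)) hA
            (fun σ _ _ => mul_nonneg (p3 _) (HDXP.D_nonneg _ _ _))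
          linarith
      _ ≤ _ := by linarith
  -- pairs of A
  have hd0 : (0:ℝ) ≤ d - j - 1 := by linarith
  have hpair : ∑ τ ∈ HDX.facesCard X (j+3), ((((τ.powersetCard (j+2)).filter (· ∈ A)).card : ℝ) *
        ((((τ.powersetCard (j+2)).filter (· ∈ A)).card : ℝ) - 1)) * HDXP.D X (d+1) τ ≤
      ((d:ℝ) - j - 1) * ((1 - α) * (W + 1 / 2 * (3 * ε * (j+1) * (j+2) * W)) 
        + (ε + ε^2) * ((j+2) * W)) := by
    have q1 := HDXP.pairs X (d+1) (j+1) hX A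
    refine q1.trans ?_
    have q2 : ∀ ρ ∈ HDX.facesCard X (j+1), HDXP.E X (d+1) A ρ ≤ ((d:ℝ) - j - 1) *
        ((1 - α) * (if ρ ∈ F then HDXP.s X (d+1) A ρ else 0) + (ε + ε^2) * HDXP.s X (d+1) A ρ) := by
      intro ρ hρ
      have h1 := HDXP.E_le X d (j+1) lam (ε^2) hX hXd hlse hlamε (sq_nonneg _) A hA ρ hρ (by omega)
      have h2 : HDX.locWt X (d+1) A (j+2) ρ ≤ 1 - α := hw2 ρ hρ
      have hs0 := HDXP.s_nonneg X (d+1) A ρ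
      refine h1.trans ?_
      push_cast
      have h3 : (d:ℝ) + 1 - (j + 1) - 1 = d - j - 1 := by ring
      rw [h3, mul_assoc]
      refine mul_le_mul_of_nonneg_left ?_ hd0
      change _ * (HDX.locWt X (d+1) A (j+2) ρ + _) ≤ _
      split_ifs with h
      · nlinarith only [mul_le_mul_of_nonneg_left h2 hs0, mul_nonneg hε0.le hs0]
      · have h4 : HDX.locWt X (d+1) A (j+2) ρ ≤ ε := by
          by_contra h5
          exact h (mem_filter.2 ⟨hρ, not_le.1 h5⟩)
        nlinarith only [mul_le_mul_of_nonneg_left h4 hs0]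
    refine (sum_le_sum q2).trans ?_
    rw [← mul_sum, sum_add_distrib, ← mul_sum, ← mul_sum, sum_ite_mem, inter_eq_right.2 hFs]
    refine mul_le_mul_of_nonneg_left ?_ hd0
    have q3 := HDXP.down0 X (d+1) (j+1) A hAc
    push_cast at q3
    have q4 := mul_le_mul_of_nonneg_left hfat (show 0 ≤ 1 - α by linarith)
    have q5 := mul_le_mul_of_nonneg_left q3 (show 0 ≤ ε + ε^2 by positivity)
    rw [← hW] at q5
    linarith
  -- singles
  have hsing : ∑ τ ∈ HDX.facesCard X (j+3), (((τ.powersetCard (j+2)).filter (· ∈ A)).card : ℝ) *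
      HDXP.D X (d+1) τ = ((d:ℝ) - j - 1) * W := by
    rw [HDXP.sum_cnt_D X (d+1) (j+2) A _ hAc, hW, mul_sum]
    refine sum_congr rfl fun σ hσ => ?_
    have := HDXP.sum_sup_all X (d+1) (j+2) hX σ (hAc σ hσ)
    unfold HDXP.s
    rw [this]
    push_cast; ring
  -- delta
  have hdel : ∑ τ ∈ HDX.delta1 X (j+2) A, HDXP.D X (d+1) τ ≥ 
      ∑ τ ∈ HDX.facesCard X (j+3), ((((τ.powersetCard (j+2)).filter (· ∈ A)).card : ℝ) *
        HDXP.D X (d+1) τ - ((((τ.powersetCard (j+2)).filter (· ∈ A)).card : ℝ) *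
        ((((τ.powersetCard (j+2)).filter (· ∈ A)).card : ℝ) - 1)) * HDXP.D X (d+1) τ) := by
    unfold HDX.delta1
    rw [sum_filter]
    refine sum_le_sum fun τ _ => ?_
    have hD := HDXP.D_nonneg X (d+1) τ
    generalize ((τ.powersetCard (j+2)).filter (· ∈ A)).card = n
    split_ifs with h
    · subst h; simp
    · have : (n:ℝ) * (2 - n) ≤ 0 := by
        rcases Nat.lt_or_ge n 2 with h' | h'
        · have : n = 0 := by omega
          simp [this]
        · have : (2:ℝ) ≤ n := by exact_mod_cast h'
          exact mul_nonpos_of_nonneg_of_nonpos (by linarith) (by linarith)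
      nlinarith only [mul_le_mul_of_nonneg_right this hD]
  rw [sum_sub_distrib, hsing] at hdel
  have w1 := HDXP.wt_mul X (d+1) (j+3) (HDX.delta1 X (j+2) A)
    (fun σ hσ => (mem_filter.1 (mem_filter.1 hσ).1).2) hN (by omega)
  have w2 := HDXP.wt_mul X (d+1) (j+2) A hAc hN (by omega)
  have c1 := HDXP.choose_cast (d+1) (j+2) (by omega)
  push_cast at c1
  have hNp : (0:ℝ) < (HDX.facesCard X (d+1)).card := by exact_mod_cast hN
  have hcp : (0:ℝ) < ((d+1).choose (j+3) : ℝ) := by exact_mod_cast Nat.choose_pos (by omega)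
  -- numeric
  have hnum : α ≤ (j + 3) * (1 - ((1 - α) * (1 + 1 / 2 * (3 * ε * (j+1) * (j+2))) 
        + (ε + ε^2) * (j+2))) := by
    exact HDXP.numeric j d ε α hj0 hj' hε0 hε1 hα0 hεα
  set Z := 1 - ((1 - α) * (1 + 1 / 2 * (3 * ε * (j+1) * (j+2))) + (ε + ε^2) * (j+2)) with hZ
  have hfin : ((d:ℝ) - j - 1) * W * Z ≤ ∑ τ ∈ HDX.delta1 X (j+2) A, HDXP.D X (d+1) τ := by
    refine le_trans (le_of_eq ?_) ((sub_le_sub_left hpair _).trans hdel)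
    rw [hZ]; ring
  rw [← w1, hW, ← w2] at hfin
  set N : ℝ := ((HDX.facesCard X (d+1)).card : ℝ)
  set wA := HDX.wt X (d+1) (j+2) A with hwA
  have hwA0 : 0 ≤ wA := by rw [hwA]; exact HDXP.wt_nonneg _ _ _ _
  have hfin2 : (j + 3) * wA * Z * (N * ((d+1).choose (j+3) : ℝ)) ≤ 
      HDX.wt X (d+1) (j+3) (HDX.delta1 X (j+2) A) * (N * ((d+1).choose (j+3) : ℝ)) := by
    refine le_trans (le_of_eq ?_) hfin
    have c2 : (((d+1).choose (j+3) : ℕ) : ℝ) * (j + 3) = ((d+1).choose (j+2) : ℝ) * (d - j - 1) := by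
      linear_combination c1
    linear_combination (wA * Z * N) * c2
  have hfin3 := le_of_mul_le_mul_right hfin2 (mul_pos hNp hcp)
  have hfin4 := mul_le_mul_of_nonneg_right hnum hwA0
  show α * HDX.wt X (d+1) (j+2) A ≤ HDX.wt X (d+1) (j+3) (HDX.delta1 X (j+2) A)
  linarith
end
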